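/- arXiv:0801.4717 — 4 statements merged into one kernel-verified Lean document; each statement's English description precedes it below -/
import Mathlib

section
/- Suppose: (Q3) the map (t,d,x) ↦ f(t,d,x) is locally Lipschitz with respect to x, i.e. for every compact S ⊂ [0,∞)×ℝⁿ one has sup{ |f(t,d,x) − f(t,d,y)|/|x−y| : (t,x) ∈ S, (t,y) ∈ S, x ≠ y, d ∈ D } < +∞; and (Q1) there exist a locally Lipschitz function V : [0,∞)×ℝⁿ → [0,∞), functions a₁, a₂ ∈ K∞, β, μ ∈ K⁺, a function q ∈ ℰ and a continuous positive definite ρ : [0,∞) → [0,∞) such that a₁(|(μ(t)x, H(t,x))|) ≤ V(t,x) ≤ a₂(β(t)|x|) for all (t,x) ∈ [0,∞)×ℝⁿ (here |(μ(t)x, H(t,x))| is the Euclidean norm of the pair in ℝⁿ⁺ᵏ), and V⁰(t, x; f(t,d,x)) ≤ −ρ(V(t,x)) + q(t) for all (t,x,d) ∈ [0,∞)×ℝⁿ×D. Then system (2.1) is RGAOS. -/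
open Filter Topology MeasureTheory Set

noncomputable section

/-- ℝⁿ with the Euclidean norm. -/
abbrev Euc (n : ℕ) := EuclideanSpace ℝ (Fin n)

/-- The Dini derivative V⁰(t,x;v) := limsup_{h→0⁺, w→v} (V(t+h, x+h·w) − V(t,x))/h,
with values in the extended reals. -/
def dini0 {n : ℕ} (V : ℝ → Euc n → ℝ) (t : ℝ) (x v : Euc n) : EReal :=
  Filter.limsup
    (fun p : ℝ × Euc n => (((V (t + p.1) (x + p.1 • p.2) - V t x) / p.1 : ℝ) : EReal))
    ((𝓝[>] (0:ℝ)) ×ˢ 𝓝 v)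

/-- Class K∞ functions (on [0,∞)). -/
def IsKinf (a : ℝ → ℝ) : Prop :=
  ContinuousOn a (Ici 0) ∧ StrictMonoOn a (Ici 0) ∧ a 0 = 0 ∧ Tendsto a atTop atTop

/-- Class K⁺: positive continuous functions on [0,∞). -/
def IsKplus (b : ℝ → ℝ) : Prop := ContinuousOn b (Ici 0) ∧ ∀ t, 0 ≤ t → 0 < b t

/-- Class ℰ: continuous nonnegative integrable functions on [0,∞) tending to 0. -/
def IsClassE (q : ℝ → ℝ) : Prop :=
  ContinuousOn q (Ici 0) ∧ (∀ t, 0 ≤ t → 0 ≤ q t) ∧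
    IntegrableOn q (Ici 0) ∧ Tendsto q atTop (𝓝 0)

/-- Continuous positive definite functions on [0,∞). -/
def IsPosDef (ρ : ℝ → ℝ) : Prop :=
  ContinuousOn ρ (Ici 0) ∧ ρ 0 = 0 ∧ (∀ s, 0 < s → 0 < ρ s) ∧ ∀ s, 0 ≤ s → 0 ≤ ρ s

/-- Membership in M_D : measurable selections of values in D. -/
def InMD {l : ℕ} (D : Set (Euc l)) (d : ℝ → Euc l) : Prop :=
  Measurable d ∧ ∀ t, d t ∈ D

/-- Euclidean norm of the pair (a,b) ∈ ℝⁿ⁺ᵏ. -/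
def pairNorm {n k : ℕ} (a : Euc n) (b : Euc k) : ℝ := Real.sqrt (‖a‖ ^ 2 + ‖b‖ ^ 2)

/-- x : [t₀, tmax) → ℝⁿ is the (absolutely continuous) solution of ẋ = F(t,d(t),x) with
x(t₀) = x₀, expressed in integral form. -/
def IsSolution {n l : ℕ} (F : ℝ → Euc l → Euc n → Euc n) (d : ℝ → Euc l)
    (t₀ : ℝ) (x₀ : Euc n) (tmax : EReal) (x : ℝ → Euc n) : Prop :=
  (t₀ : EReal) < tmax ∧ x t₀ = x₀ ∧
    ContinuousOn x {t : ℝ | t₀ ≤ t ∧ (t : EReal) < tmax} ∧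
    ∀ t, t₀ ≤ t → (t : EReal) < tmax → x t = x₀ + ∫ s in t₀..t, F s (d s) (x s)

lemma deriv_le_dini {n : ℕ} (V : ℝ → Euc n → ℝ) (x : ℝ → Euc n) (w : Euc n) (t v' : ℝ)
    (hx : HasDerivAt x w t) (hv : HasDerivAt (fun s => V s (x s)) v' t) :
    (v' : EReal) ≤ dini0 V t (x t) w := by
  have hm : Tendsto (fun h : ℝ => (h, h⁻¹ • (x (t + h) - x t))) (𝓝[>] 0)
      ((𝓝[>] (0:ℝ)) ×ˢ 𝓝 w) := by
    refine Tendsto.prodMk tendsto_id ?_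
    exact (hasDerivAt_iff_tendsto_slope_zero.1 hx).mono_left
      (nhdsWithin_mono _ (fun y hy => ne_of_gt hy))
  have hg : Tendsto (fun h : ℝ => ((h⁻¹ • (V (t + h) (x (t + h)) - V t (x t)) : ℝ) : EReal))
      (𝓝[>] 0) (𝓝 (v' : EReal)) := by
    refine (continuous_coe_real_ereal.tendsto v').comp ?_
    exact (hasDerivAt_iff_tendsto_slope_zero.1 hv).mono_left
      (nhdsWithin_mono _ (fun y hy => ne_of_gt hy))
  unfold dini0
  refine le_trans (le_of_eq ?_) (limsup_le_limsup_of_le hm)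
  rw [← hg.limsup_eq]
  rw [Filter.limsup, Filter.limsup, Filter.map_map]
  congr 1
  apply Filter.map_congr
  filter_upwards [self_mem_nhdsWithin] with h hh
  have hh' : h ≠ 0 := ne_of_gt hh
  simp only [Function.comp]
  congr 1
  rw [smul_smul, mul_inv_cancel₀ hh', one_smul, add_sub_cancel, smul_eq_mul]
  rw [div_eq_inv_mul]

lemma f_bound {n l : ℕ} {D : Set (Euc l)} (hD : IsCompact D)
    {f : ℝ → Euc l → Euc n → Euc n}
    (hf_cont : ContinuousOn (fun p : ℝ × Euc l × Euc n => f p.1 p.2.1 p.2.2)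
      (Ici 0 ×ˢ D ×ˢ univ)) (B M : ℝ) :
    ∃ N, 0 ≤ N ∧ ∀ t ∈ Icc 0 B, ∀ d ∈ D, ∀ x, ‖x‖ ≤ M → ‖f t d x‖ ≤ N := by
  have hc : IsCompact (Icc (0:ℝ) B ×ˢ D ×ˢ Metric.closedBall (0 : Euc n) M) :=
    isCompact_Icc.prod (hD.prod (isCompact_closedBall _ _))
  obtain ⟨N, hN⟩ := hc.exists_bound_of_continuousOn
    (hf_cont.mono (Set.prod_mono Icc_subset_Ici_self (Set.prod_mono le_rfl (subset_univ _))))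
  refine ⟨max N 0, le_max_right _ _, fun t ht d hd x hx => ?_⟩
  exact (hN (t, d, x) ⟨ht, hd, by simpa using hx⟩).trans (le_max_left _ _)

lemma f_int {n l : ℕ} {D : Set (Euc l)} (hD : IsCompact D)
    {f : ℝ → Euc l → Euc n → Euc n}
    (hf_cont : ContinuousOn (fun p : ℝ × Euc l × Euc n => f p.1 p.2.1 p.2.2)
      (Ici 0 ×ˢ D ×ˢ univ)) {d : ℝ → Euc l} (hd : InMD D d) {x : ℝ → Euc n} {S : Set ℝ}
    (hS : MeasurableSet S) {B M : ℝ} (hSB : S ⊆ Icc 0 B) (hx : ContinuousOn x S)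
    (hM : ∀ t ∈ S, ‖x t‖ ≤ M) : IntegrableOn (fun s => f s (d s) (x s)) S := by
  classical
  obtain ⟨N, hN0, hN⟩ := f_bound hD hf_cont B M
  have hK : MeasurableSet ((Ici (0:ℝ)) ×ˢ D ×ˢ (univ : Set (Euc n))) :=
    measurableSet_Ici.prod (hD.measurableSet.prod MeasurableSet.univ)
  have hF : Measurable (((Ici (0:ℝ)) ×ˢ D ×ˢ (univ : Set (Euc n))).piecewise
      (fun p : ℝ × Euc l × Euc n => f p.1 p.2.1 p.2.2) (fun _ => 0)) :=
    hf_cont.measurable_piecewise continuousOn_const hK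
  have hxm : AEMeasurable x (volume.restrict S) := hx.aemeasurable hS
  have hm : AEMeasurable (fun s => (s, d s, x s)) (volume.restrict S) :=
    aemeasurable_id.prodMk (hd.1.aemeasurable.prodMk hxm)
  have h1 := hF.comp_aemeasurable hm
  have h2 : AEStronglyMeasurable (fun s => f s (d s) (x s)) (volume.restrict S) := by
    refine AEMeasurable.aestronglyMeasurable (h1.congr ?_)
    filter_upwards [ae_restrict_mem hS] with s hs
    have : (s, d s, x s) ∈ ((Ici (0:ℝ)) ×ˢ D ×ˢ (univ : Set (Euc n))) :=
      ⟨(hSB hs).1, hd.2 s, trivial⟩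
    simp only [Function.comp]
    rw [Set.piecewise_eq_of_mem _ _ _ this]
  have hfin : volume S < ⊤ := (measure_mono hSB).trans_lt measure_Icc_lt_top
  have : IsFiniteMeasure (volume.restrict S) := ⟨by simpa using hfin⟩
  refine Integrable.of_bound h2 N ?_
  filter_upwards [ae_restrict_mem hS] with s hs
  exact hN s (hSB hs) _ (hd.2 s) _ (hM s hs)

lemma gron {u : ℝ → ℝ} {a b c L : ℝ} (hab : a ≤ b) (hL : 0 < L) (hu : ContinuousOn u (Icc a b))
    (h : ∀ t ∈ Icc a b, u t ≤ c + L * ∫ s in a..t, u s) :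
    ∀ t ∈ Icc a b, u t ≤ c * Real.exp (L * (t - a)) := by
  have hw : Continuous (IccExtend hab (domRestrict (Icc a b) u)) :=
    (continuousOn_iff_continuous_domRestrict.1 hu).Icc_extend'
  set w := IccExtend hab (domRestrict (Icc a b) u) with hwdef
  have hwu : ∀ t ∈ Icc a b, w t = u t := fun t ht => by
    rw [hwdef, IccExtend_of_mem _ _ ht]; rfl
  have hint : ∀ t ∈ Icc a b, ∫ s in a..t, u s = ∫ s in a..t, w s := by
    intro t ht
    apply intervalIntegral.integral_congr
    intro s hs
    rw [uIcc_of_le ht.1] at hs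
    exact (hwu s ⟨hs.1, hs.2.trans ht.2⟩).symm
  have hder : ∀ t, HasDerivAt (fun t => ∫ s in a..t, w s) (w t) t := fun t =>
    hw.integral_hasStrictDerivAt a t |>.hasDerivAt
  have key := le_gronwallBound_of_liminf_deriv_right_le (f := fun t => ∫ s in a..t, w s) (f' := w)
    (δ := 0) (K := L) (ε := c) (a := a) (b := b)
    (fun t _ => (hder t).continuousAt.continuousWithinAt)
    (fun t _ r hr => ((hder t).hasDerivWithinAt).liminf_right_slope_le hr)
    (by simp) (fun t ht => by
      have := h t ⟨ht.1, ht.2.le⟩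
      rw [hint t ⟨ht.1, ht.2.le⟩] at this
      rw [hwu t ⟨ht.1, ht.2.le⟩]; linarith)
  intro t ht
  have k := key t ht
  have h1 := h t ht
  rw [hint t ht] at h1
  rw [gronwallBound_of_K_ne_0 hL.ne'] at k
  have : L * (0 * Real.exp (L * (t - a)) + c / L * (Real.exp (L * (t - a)) - 1)) =
    c * Real.exp (L * (t - a)) - c := by field_simp; ring
  have := mul_le_mul_of_nonneg_left k hL.le
  linarith

lemma sol_int {n l : ℕ} {D : Set (Euc l)} (hD : IsCompact D)
    {f : ℝ → Euc l → Euc n → Euc n}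
    (hf_cont : ContinuousOn (fun p : ℝ × Euc l × Euc n => f p.1 p.2.1 p.2.2)
      (Ici 0 ×ˢ D ×ˢ univ)) {d : ℝ → Euc l} (hd : InMD D d) {x : ℝ → Euc n} {a b : ℝ}
    (ha : 0 ≤ a) (hab : a ≤ b) (hx : ContinuousOn x (Icc a b)) :
    IntervalIntegrable (fun s => f s (d s) (x s)) volume a b := by
  obtain ⟨M, hM⟩ := isCompact_Icc.exists_bound_of_continuousOn hx
  rw [intervalIntegrable_iff_integrableOn_Icc_of_le hab]
  exact f_int hD hf_cont hd measurableSet_Icc (Icc_subset_Icc_left ha) hx hM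

lemma lyap {n l : ℕ} {D : Set (Euc l)} (hD : IsCompact D)
    {f : ℝ → Euc l → Euc n → Euc n}
    (hf_cont : ContinuousOn (fun p : ℝ × Euc l × Euc n => f p.1 p.2.1 p.2.2)
      (Ici 0 ×ˢ D ×ˢ univ)) {d : ℝ → Euc l} (hd : InMD D d)
    {V : ℝ → Euc n → ℝ} (hVpos : ∀ t x, 0 ≤ V t x)
    (hVlip : LocallyLipschitz (fun p : ℝ × Euc n => V p.1 p.2))
    {q ρ : ℝ → ℝ} (hq : IsClassE q) (hρ : IsPosDef ρ)
    (hVdecr : ∀ t, 0 ≤ t → ∀ x : Euc n, ∀ d ∈ D,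
      dini0 V t x (f t d x) ≤ ((-ρ (V t x) + q t : ℝ) : EReal))
    {x : ℝ → Euc n} {t₀ : ℝ} {x₀ : Euc n} {tm : EReal} (h0 : 0 ≤ t₀)
    (hs : IsSolution f d t₀ x₀ tm x) {t₁ t₂ : ℝ} (h1 : t₀ ≤ t₁) (h12 : t₁ ≤ t₂)
    (h2 : (t₂ : EReal) < tm) :
    IntervalIntegrable (fun s => -ρ (V s (x s)) + q s) volume t₁ t₂ ∧
    IntervalIntegrable (fun s => q s) volume t₁ t₂ ∧
    V t₂ (x t₂) ≤ V t₁ (x t₁) + ∫ s in t₁..t₂, (-ρ (V s (x s)) + q s) := by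
  obtain ⟨hlt, hx0, hxc, hxe⟩ := hs
  have h02 : t₀ ≤ t₂ := h1.trans h12
  have hlt' : ∀ t ∈ Icc t₀ t₂, (t : EReal) < tm := fun t ht =>
    lt_of_le_of_lt (by exact_mod_cast ht.2) h2
  have hxc' : ContinuousOn x (Icc t₀ t₂) := hxc.mono fun t ht => ⟨ht.1, hlt' t ht⟩
  have hgi := sol_int hD hf_cont hd h0 h02 hxc'
  obtain ⟨M, hM⟩ := isCompact_Icc.exists_bound_of_continuousOn hxc'
  obtain ⟨N, hN0, hN⟩ := f_bound hD hf_cont t₂ M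
  have hxl : LipschitzOnWith N.toNNReal x (Icc t₀ t₂) := by
    refine LipschitzOnWith.of_dist_le_mul fun t ht s hs => ?_
    rw [Real.coe_toNNReal _ hN0, dist_eq_norm, Real.dist_eq]
    have hi : ∀ r ∈ Icc t₀ t₂, IntervalIntegrable (fun s => f s (d s) (x s)) volume t₀ r :=
      fun r hr => hgi.mono_set (by rw [uIcc_of_le hr.1, uIcc_of_le h02]; exact Icc_subset_Icc_right hr.2)
    rw [hxe t ht.1 (hlt' t ht), hxe s hs.1 (hlt' s hs), add_sub_add_left_eq_sub,
      intervalIntegral.integral_interval_sub_left (hi t ht) (hi s hs)]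
    apply intervalIntegral.norm_integral_le_of_norm_le_const
    intro r hr
    have hr' : r ∈ Icc t₀ t₂ := by
      have := uIoc_subset_uIcc hr
      exact (uIcc_subset_Icc hs ht) this
    exact hN r ⟨h0.trans hr'.1, hr'.2⟩ _ (hd.2 r) _ (hM r hr')
  have hpl : LipschitzOnWith (max 1 N.toNNReal) (fun s => (s, x s)) (Icc t₀ t₂) :=
    (LipschitzWith.id.lipschitzOnWith).prodMk hxl
  have hcK : IsCompact ((fun s => (s, x s)) '' Icc t₀ t₂) := isCompact_Icc.image_of_continuousOn hpl.continuousOn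
  obtain ⟨K, hK⟩ := (hVlip.locallyLipschitzOn (s := (fun s => (s, x s)) '' Icc t₀ t₂)).exists_lipschitzOnWith_of_compact hcK
  have hvl : LipschitzOnWith (K * max 1 N.toNNReal) (fun s => V s (x s)) (Icc t₀ t₂) :=
    hK.comp hpl (mapsTo_image _ _)
  have hsub : Icc t₁ t₂ ⊆ Icc t₀ t₂ := Icc_subset_Icc_left h1
  have hac : AbsolutelyContinuousOnInterval (fun s => V s (x s)) t₁ t₂ := by
    apply LipschitzOnWith.absolutelyContinuousOnInterval (K := K * max 1 N.toNNReal)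
    rw [uIcc_of_le h12]
    exact hvl.mono hsub
  have hvc : ContinuousOn (fun s => V s (x s)) (Icc t₁ t₂) := hvl.continuousOn.mono hsub
  have hρc : ContinuousOn (fun s => ρ (V s (x s))) (Icc t₁ t₂) :=
    hρ.1.comp hvc (fun s _ => hVpos _ _)
  have hqc : ContinuousOn q (Icc t₁ t₂) := hq.1.mono fun s hs => (h0.trans h1).trans hs.1
  have hi2 : IntervalIntegrable (fun s => -ρ (V s (x s)) + q s) volume t₁ t₂ :=
    (hρc.neg.add hqc).intervalIntegrable_of_Icc h12
  refine ⟨hi2, hqc.intervalIntegrable_of_Icc h12, ?_⟩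
  have hmono : ∫ s in t₁..t₂, deriv (fun s => V s (x s)) s ≤ ∫ s in t₁..t₂, (-ρ (V s (x s)) + q s) := by
    apply intervalIntegral.integral_mono_ae_restrict h12 hac.intervalIntegrable_deriv hi2
    have e1 : ∀ᵐ s, s ≠ t₁ := by simp [ae_iff, measure_singleton]
    have e2 : ∀ᵐ s, s ≠ t₂ := by simp [ae_iff, measure_singleton]
    rw [Filter.EventuallyLE, ae_restrict_iff' measurableSet_Icc]
    filter_upwards [e1, e2, hac.ae_differentiableAt, hgi.ae_hasDerivAt_integral] with s n1 n2 hds hgs hsI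
    have hsI0 := hsub hsI
    have hd1 := (hds (by rwa [uIcc_of_le h12])).hasDerivAt
    have hd2 := hgs (by rwa [uIcc_of_le h02]) t₀ (by simp)
    have hd3 : HasDerivAt x (f s (d s) (x s)) s := by
      refine (hd2.const_add x₀).congr_of_eventuallyEq ?_
      have : Ioo t₁ t₂ ∈ 𝓝 s := Ioo_mem_nhds (lt_of_le_of_ne hsI.1 n1.symm) (lt_of_le_of_ne hsI.2 n2)
      filter_upwards [this] with r hr
      have hr' := hsub (Ioo_subset_Icc_self hr)
      exact hxe r hr'.1 (hlt' r hr')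
    have := (deriv_le_dini V x _ s _ hd3 hd1).trans (hVdecr s (h0.trans hsI0.1) (x s) (d s) (hd.2 s))
    exact_mod_cast this
  have := hac.integral_deriv_eq_sub
  linarith

lemma ext_sol {n l : ℕ} {D : Set (Euc l)} (hD : IsCompact D)
    {f : ℝ → Euc l → Euc n → Euc n}
    (hf_cont : ContinuousOn (fun p : ℝ × Euc l × Euc n => f p.1 p.2.1 p.2.2)
      (Ici 0 ×ˢ D ×ˢ univ))
    (X : ℝ → Euc n → (ℝ → Euc l) → ℝ → Euc n)
    (tmax : ℝ → Euc n → (ℝ → Euc l) → EReal)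
    (hX : ∀ t₀, 0 ≤ t₀ → ∀ x₀ d, InMD D d →
      IsSolution f d t₀ x₀ (tmax t₀ x₀ d) (X t₀ x₀ d))
    (hXmax : ∀ t₀, 0 ≤ t₀ → ∀ x₀ d, InMD D d → ∀ tm y, IsSolution f d t₀ x₀ tm y →
      tm ≤ tmax t₀ x₀ d ∧ ∀ t, t₀ ≤ t → (t : EReal) < tm → y t = X t₀ x₀ d t)
    {d : ℝ → Euc l} (hd : InMD D d) {t₀ : ℝ} (h0 : 0 ≤ t₀) (x₀ : Euc n) (b M : ℝ)
    (hb : tmax t₀ x₀ d = b) (hM : ∀ t ∈ Ico t₀ b, ‖X t₀ x₀ d t‖ ≤ M) : False := by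
  obtain ⟨hlt, hx0, hxc, hxe⟩ := hX t₀ h0 x₀ d hd
  rw [hb] at hlt hxc hxe
  have hlt' : t₀ < b := by exact_mod_cast hlt
  have hset : {t : ℝ | t₀ ≤ t ∧ (t : EReal) < (b : EReal)} = Ico t₀ b := by
    ext t; simp
  rw [hset] at hxc
  set x := X t₀ x₀ d with hxdef
  have hgi : IntegrableOn (fun s => f s (d s) (x s)) (Ico t₀ b) :=
    f_int hD hf_cont hd measurableSet_Ico (B := b) (fun t ht => ⟨h0.trans ht.1, ht.2.le⟩) hxc hM
  have hgi' : IntervalIntegrable (fun s => f s (d s) (x s)) volume t₀ b := by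
    rw [intervalIntegrable_iff_integrableOn_Ico_of_le hlt'.le]; exact hgi
  set xs := x₀ + ∫ s in t₀..b, f s (d s) (x s) with hxs
  obtain ⟨klt, kx0, kxc, kxe⟩ := hX b (h0.trans hlt'.le) xs d hd
  set z := X b xs d with hz
  set tm := tmax b xs d with htm
  set y : ℝ → Euc n := fun t => if t < b then x t else z t with hy
  have hye1 : ∀ t, t < b → y t = x t := fun t ht => by simp [hy, ht]
  have hye2 : ∀ t, b ≤ t → y t = z t := fun t ht => by simp [hy, not_lt.2 ht]
  have i1 : IntervalIntegrable (fun s => f s (d s) (y s)) volume t₀ b := by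
    rw [intervalIntegrable_iff_integrableOn_Ico_of_le hlt'.le]
    refine hgi.congr_fun (fun s hs => ?_) measurableSet_Ico
    simp only [hye1 s hs.2]
  have i2 : ∀ t, b ≤ t → (t : EReal) < tm → IntervalIntegrable (fun s => f s (d s) (y s)) volume b t := by
    intro t ht htt
    have : IntervalIntegrable (fun s => f s (d s) (z s)) volume b t :=
      sol_int hD hf_cont hd (h0.trans hlt'.le) ht
        (kxc.mono fun s hs => ⟨hs.1, lt_of_le_of_lt (by exact_mod_cast hs.2) htt⟩)
    rw [intervalIntegrable_iff_integrableOn_Icc_of_le ht] at this ⊢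
    refine this.congr_fun (fun s hs => ?_) measurableSet_Icc
    simp only [hye2 s hs.1]
  have e0 : ∀ t, t₀ ≤ t → t ≤ b → ∫ s in t₀..t, f s (d s) (y s) = ∫ s in t₀..t, f s (d s) (x s) := by
    intro t ht htb
    rw [intervalIntegral.integral_of_le ht, intervalIntegral.integral_of_le ht,
      integral_Ioc_eq_integral_Ioo, integral_Ioc_eq_integral_Ioo]
    refine setIntegral_congr_fun measurableSet_Ioo fun s hs => ?_
    simp only [hye1 s (hs.2.trans_le htb)]
  have hyeq : ∀ t, t₀ ≤ t → (t : EReal) < tm → y t = x₀ + ∫ s in t₀..t, f s (d s) (y s) := by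
    intro t ht htt
    rcases lt_or_ge t b with h | h
    · rw [hye1 t h, e0 t ht h.le]
      exact hxe t ht (by exact_mod_cast h)
    · rw [hye2 t h, ← intervalIntegral.integral_add_adjacent_intervals i1 (i2 t h htt),
        e0 b hlt'.le le_rfl, ← add_assoc, ← hxs, kxe t h htt]
      congr 1
      apply intervalIntegral.integral_congr
      intro s hs
      rw [uIcc_of_le h] at hs
      simp only [hye2 s hs.1]
  have iall : ∀ t, b ≤ t → (t : EReal) < tm → IntervalIntegrable (fun s => f s (d s) (y s)) volume t₀ t :=
    fun t ht htt => i1.trans (i2 t ht htt)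
  have hsol : IsSolution f d t₀ x₀ tm y := by
    refine ⟨hlt.trans klt, ?_, ?_, hyeq⟩
    · rw [hye1 t₀ hlt', hx0]
    · intro t ht
      obtain ⟨c, hc1, hc2⟩ : ∃ c : ℝ, (max t b : ℝ) < c ∧ (c : EReal) < tm := by
        have : ((max t b : ℝ) : EReal) < tm := by
          rcases max_cases t b with h | h
          · rw [h.1]; exact ht.2
          · rw [h.1]; exact klt
        obtain ⟨c, hc1, hc2⟩ := EReal.lt_iff_exists_real_btwn.1 this
        exact ⟨c, by exact_mod_cast hc1, hc2⟩
      have hbc : b ≤ c := (le_max_right t b).trans hc1.le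
      have htc : t < c := (le_max_left t b).trans_lt hc1
      have hco : ContinuousOn (fun t => x₀ + ∫ s in t₀..t, f s (d s) (y s)) (Icc t₀ c) := by
        have := intervalIntegral.continuousOn_primitive_interval' (iall c hbc hc2) (a := t₀) (by simp)
        rw [uIcc_of_le (hlt'.le.trans hbc)] at this
        exact continuousOn_const.add this
      have hco2 : ContinuousOn y (Icc t₀ c) := hco.congr fun s hs =>
        hyeq s hs.1 (lt_of_le_of_lt (by exact_mod_cast hs.2) hc2)
      refine (hco2 t ⟨ht.1, htc.le⟩).mono_of_mem_nhdsWithin ?_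
      rw [mem_nhdsWithin]
      exact ⟨Iio c, isOpen_Iio, htc, fun s hs => ⟨hs.2.1, hs.1.le⟩⟩
  have := (hXmax t₀ h0 x₀ d hd tm y hsol).1
  rw [hb] at this
  exact absurd klt (not_lt.2 this)

lemma q_tail {q : ℝ → ℝ} (hq : IsClassE q) :
    (∃ I, 0 ≤ I ∧ ∀ t₁ t₂, 0 ≤ t₁ → t₁ ≤ t₂ → ∫ s in t₁..t₂, q s ≤ I) ∧
    (∀ η, 0 < η → ∃ T', 0 ≤ T' ∧ ∀ t₁ t₂, T' ≤ t₁ → t₁ ≤ t₂ → ∫ s in t₁..t₂, q s ≤ η) := by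
  obtain ⟨hc, h0, hi, -⟩ := hq
  have hint : ∀ a b, 0 ≤ a → a ≤ b → IntervalIntegrable q volume a b := fun a b ha hab =>
    (hc.mono fun s hs => ha.trans hs.1).intervalIntegrable_of_Icc hab
  have hnn : ∀ a b, 0 ≤ a → a ≤ b → 0 ≤ ∫ s in a..b, q s := fun a b ha hab =>
    intervalIntegral.integral_nonneg hab fun s hs => h0 s (ha.trans hs.1)
  have hadd : ∀ a b, 0 ≤ a → a ≤ b → ∫ s in a..b, q s = (∫ s in 0..b, q s) - ∫ s in 0..a, q s := by
    intro a b ha hab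
    rw [← intervalIntegral.integral_add_adjacent_intervals (hint 0 a le_rfl ha) (hint a b ha hab)]
    ring
  have ht : Tendsto (fun t => ∫ s in 0..t, q s) atTop (𝓝 (∫ s in Ioi 0, q s)) :=
    intervalIntegral_tendsto_integral_Ioi 0 (hi.mono_set Ioi_subset_Ici_self) tendsto_id
  have hle : ∀ t, 0 ≤ t → ∫ s in 0..t, q s ≤ ∫ s in Ioi 0, q s := by
    intro t ht0
    apply ge_of_tendsto ht
    filter_upwards [eventually_ge_atTop t] with r hr
    have := hnn t r ht0 hr
    rw [hadd t r ht0 hr] at this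
    linarith
  refine ⟨⟨∫ s in Ioi 0, q s, ?_, ?_⟩, ?_⟩
  · simpa using hle 0 le_rfl
  · intro t₁ t₂ h1 h12
    have := hnn 0 t₁ le_rfl h1
    have := hle t₂ (h1.trans h12)
    rw [hadd t₁ t₂ h1 h12]; linarith
  · intro η hη
    obtain ⟨T', hT'⟩ := eventually_atTop.1 (ht.eventually_const_lt
      (show (∫ s in Ioi 0, q s) - η < ∫ s in Ioi 0, q s by linarith))
    refine ⟨max T' 0, le_max_right _ _, fun t₁ t₂ h1 h12 => ?_⟩
    have h1' : 0 ≤ t₁ := (le_max_right _ _).trans h1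
    have := hT' t₁ ((le_max_left _ _).trans h1)
    have := hle t₂ (h1'.trans h12)
    rw [hadd t₁ t₂ h1' h12]; linarith

lemma kplus_bounds {b : ℝ → ℝ} (hb : IsKplus b) (T : ℝ) (hT : 0 ≤ T) :
    ∃ m M, 0 < m ∧ 0 < M ∧ ∀ t ∈ Icc 0 T, m ≤ b t ∧ b t ≤ M := by
  have hc : ContinuousOn b (Icc 0 T) := hb.1.mono Icc_subset_Ici_self
  have hne : (Icc 0 T).Nonempty := ⟨0, le_rfl, hT⟩
  obtain ⟨u, hu, hu'⟩ := isCompact_Icc.exists_isMinOn hne hc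
  obtain ⟨w, hw, hw'⟩ := isCompact_Icc.exists_isMaxOn hne hc
  exact ⟨b u, b w, hb.2 u hu.1, hb.2 w hw.1, fun t ht => ⟨hu' ht, hw' ht⟩⟩

lemma kinf_small {a : ℝ → ℝ} (ha : IsKinf a) (η : ℝ) (hη : 0 < η) :
    ∃ δ, 0 < δ ∧ a δ ≤ η := by
  have h1 : Tendsto a (𝓝[>] 0) (𝓝 0) := by
    have := (ha.1 0 self_mem_Ici).tendsto
    rw [ha.2.2.1] at this
    exact this.mono_left (nhdsWithin_mono _ Ioi_subset_Ici_self)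
  obtain ⟨δ, h, h'⟩ := ((h1.eventually_le_const hη).and self_mem_nhdsWithin).exists
  exact ⟨δ, h', h⟩

/-- Proposition 2.5 (RGAOS part): under hypotheses (Q1) and (Q3), system (2.1) is RGAOS. -/
theorem stmt1 {n l k : ℕ}
    (D : Set (Euc l)) (hD : IsCompact D) (hDne : D.Nonempty)
    (f : ℝ → Euc l → Euc n → Euc n) (H : ℝ → Euc n → Euc k)
    (hf_cont : ContinuousOn (fun p : ℝ × Euc l × Euc n => f p.1 p.2.1 p.2.2)
      (Ici 0 ×ˢ D ×ˢ univ))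
    (hf0 : ∀ t, 0 ≤ t → ∀ d ∈ D, f t d 0 = 0)
    (hH_cont : ContinuousOn (fun p : ℝ × Euc n => H p.1 p.2) (Ici 0 ×ˢ univ))
    (hH0 : ∀ t, 0 ≤ t → H t 0 = 0)
    -- hypothesis (Q3): local Lipschitz continuity of f with respect to x
    (hQ3 : ∀ S : Set (ℝ × Euc n), IsCompact S → S ⊆ Ici 0 ×ˢ univ →
      ∃ L, ∀ d ∈ D, ∀ t x y, (t, x) ∈ S → (t, y) ∈ S →
        ‖f t d x - f t d y‖ ≤ L * ‖x - y‖)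
    -- the (assumed unique maximal) solution family of system (2.1)
    (X : ℝ → Euc n → (ℝ → Euc l) → ℝ → Euc n)
    (tmax : ℝ → Euc n → (ℝ → Euc l) → EReal)
    (hX : ∀ t₀, 0 ≤ t₀ → ∀ x₀ d, InMD D d →
      IsSolution f d t₀ x₀ (tmax t₀ x₀ d) (X t₀ x₀ d))
    (hXmax : ∀ t₀, 0 ≤ t₀ → ∀ x₀ d, InMD D d → ∀ tm y, IsSolution f d t₀ x₀ tm y →
      tm ≤ tmax t₀ x₀ d ∧ ∀ t, t₀ ≤ t → (t : EReal) < tm → y t = X t₀ x₀ d t)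
    -- hypothesis (Q1): the Lyapunov function and comparison functions
    (V : ℝ → Euc n → ℝ) (hVpos : ∀ t x, 0 ≤ V t x)
    (hVlip : LocallyLipschitz (fun p : ℝ × Euc n => V p.1 p.2))
    (a₁ a₂ β μ q ρ : ℝ → ℝ)
    (ha₁ : IsKinf a₁) (ha₂ : IsKinf a₂) (hβ : IsKplus β) (hμ : IsKplus μ)
    (hq : IsClassE q) (hρ : IsPosDef ρ)
    (hVbounds : ∀ t, 0 ≤ t → ∀ x : Euc n,
      a₁ (pairNorm (μ t • x) (H t x)) ≤ V t x ∧ V t x ≤ a₂ (β t * ‖x‖))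
    (hVdecr : ∀ t, 0 ≤ t → ∀ x : Euc n, ∀ d ∈ D,
      dini0 V t x (f t d x) ≤ ((-ρ (V t x) + q t : ℝ) : EReal)) :
    -- conclusion: system (2.1) is RGAOS.
    -- Robust Forward Completeness:
    (∀ T, 0 ≤ T → ∀ rr, 0 ≤ rr → ∃ M, ∀ t₀ ∈ Icc (0:ℝ) T, ∀ h ∈ Icc (0:ℝ) T,
      ∀ x₀ : Euc n, ‖x₀‖ ≤ rr → ∀ d, InMD D d →
        ((t₀ + h : ℝ) : EReal) < tmax t₀ x₀ d ∧ ‖X t₀ x₀ d (t₀ + h)‖ ≤ M) ∧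
    -- P1 (Output Stability):
    (∀ ε, 0 < ε → ∀ T, 0 ≤ T →
      (∃ M, ∀ t₀ ∈ Icc (0:ℝ) T, ∀ x₀ : Euc n, ‖x₀‖ ≤ ε → ∀ d, InMD D d →
        ∀ t, t₀ ≤ t → (t : EReal) < tmax t₀ x₀ d → ‖H t (X t₀ x₀ d t)‖ ≤ M) ∧
      (∃ δ, 0 < δ ∧ ∀ t₀ ∈ Icc (0:ℝ) T, ∀ x₀ : Euc n, ‖x₀‖ ≤ δ → ∀ d, InMD D d →
        ∀ t, t₀ ≤ t → (t : EReal) < tmax t₀ x₀ d → ‖H t (X t₀ x₀ d t)‖ ≤ ε)) ∧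
    -- P2 (Uniform Output Attractivity on compact sets of initial data):
    (∀ ε, 0 < ε → ∀ T, 0 ≤ T → ∀ R, 0 ≤ R → ∃ τ, 0 ≤ τ ∧
      ∀ t₀ ∈ Icc (0:ℝ) T, ∀ x₀ : Euc n, ‖x₀‖ ≤ R → ∀ d, InMD D d →
        ∀ t, t₀ + τ ≤ t → (t : EReal) < tmax t₀ x₀ d → ‖H t (X t₀ x₀ d t)‖ ≤ ε) := by
  -- output estimates from bounds on `V`
  have hout : ∀ ε, 0 ≤ ε → ∀ t, 0 ≤ t → ∀ x : Euc n, V t x ≤ a₁ ε →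
      μ t * ‖x‖ ≤ ε ∧ ‖H t x‖ ≤ ε := by
    intro ε hε t ht x hV
    have h1 := ((hVbounds t ht x).1).trans hV
    have hp : 0 ≤ pairNorm (μ t • x) (H t x) := Real.sqrt_nonneg _
    have h2 : pairNorm (μ t • x) (H t x) ≤ ε := (ha₁.2.1.le_iff_le hp hε).1 h1
    have hμt := hμ.2 t ht
    have h3 : ‖μ t • x‖ = μ t * ‖x‖ := by rw [norm_smul, Real.norm_of_nonneg hμt.le]
    constructor
    · rw [← h3]
      exact (Real.le_sqrt_of_sq_le (by nlinarith [sq_nonneg ‖H t x‖])).trans h2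
    · exact (Real.le_sqrt_of_sq_le (by nlinarith [sq_nonneg ‖μ t • x‖])).trans h2
  obtain ⟨⟨I, hI0, hI⟩, hqt⟩ := q_tail hq
  have hly := fun {t₀ : ℝ} (h0 : 0 ≤ t₀) (x₀ : Euc n) {d : ℝ → Euc l} (hd : InMD D d) {t₁ t₂ : ℝ}
      (h1 : t₀ ≤ t₁) (h12 : t₁ ≤ t₂) (h2 : (t₂ : EReal) < tmax t₀ x₀ d) =>
    lyap hD hf_cont hd hVpos hVlip hq hρ hVdecr h0 (hX t₀ h0 x₀ d hd) h1 h12 h2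
  have hv1 : ∀ t₀ : ℝ, 0 ≤ t₀ → ∀ x₀ d, InMD D d → ∀ t₁ t₂ : ℝ, t₀ ≤ t₁ → t₁ ≤ t₂ →
      (t₂ : EReal) < tmax t₀ x₀ d →
      V t₂ (X t₀ x₀ d t₂) ≤ V t₁ (X t₀ x₀ d t₁) + ∫ s in t₁..t₂, q s := by
    intro t₀ h0 x₀ d hd t₁ t₂ h1 h12 h2
    obtain ⟨i1, i2, h⟩ := hly h0 x₀ hd h1 h12 h2
    have := intervalIntegral.integral_mono_on h12 i1 i2 (fun s _ => by
      have := hρ.2.2.2 _ (hVpos s (X t₀ x₀ d s)); linarith)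
    linarith
  have hup : ∀ B, 0 ≤ B → ∀ t, 0 ≤ t → ∀ x : Euc n, β t * ‖x‖ ≤ B → V t x ≤ a₂ B := by
    intro B hB t ht x h
    refine (hVbounds t ht x).2.trans ?_
    exact (ha₂.2.1.le_iff_le (mul_nonneg (hβ.2 t ht).le (norm_nonneg _)) hB).2 h
  have hC : ∀ T, 0 ≤ T → ∀ r, 0 ≤ r → ∃ K, 0 ≤ K ∧ ∀ t₀ ∈ Icc (0:ℝ) T, ∀ x₀ : Euc n, ‖x₀‖ ≤ r →
      ∀ d, InMD D d → ∀ t, t₀ ≤ t → (t : EReal) < tmax t₀ x₀ d → V t (X t₀ x₀ d t) ≤ a₁ K := by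
    intro T hT r hr
    obtain ⟨_, B, _, hB, hβB⟩ := kplus_bounds hβ T hT
    obtain ⟨K, hK, hK0⟩ := ((ha₁.2.2.2.eventually_ge_atTop (a₂ (B * r) + I)).and
      (eventually_ge_atTop (0:ℝ))).exists
    refine ⟨K, hK0, fun t₀ ht₀ x₀ hx₀ d hd t ht htt => ?_⟩
    have h1 := hv1 t₀ ht₀.1 x₀ d hd t₀ t le_rfl ht htt
    rw [(hX t₀ ht₀.1 x₀ d hd).2.1] at h1
    have h2 := hup (B * r) (by positivity) t₀ ht₀.1 x₀
      (mul_le_mul (hβB t₀ ht₀).2 hx₀ (norm_nonneg _) hB.le)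
    have h3 := hI t₀ t ht₀.1 ht
    linarith
  have hxb : ∀ T, 0 ≤ T → ∀ r, 0 ≤ r → ∀ S, 0 ≤ S → ∃ M, ∀ t₀ ∈ Icc (0:ℝ) T, ∀ x₀ : Euc n,
      ‖x₀‖ ≤ r → ∀ d, InMD D d → ∀ t, t₀ ≤ t → t ≤ S → (t : EReal) < tmax t₀ x₀ d →
      ‖X t₀ x₀ d t‖ ≤ M := by
    intro T hT r hr S hS
    obtain ⟨K, hK0, hK⟩ := hC T hT r hr
    obtain ⟨m, _, hm, _, hμm⟩ := kplus_bounds hμ S hS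
    refine ⟨K / m, fun t₀ ht₀ x₀ hx₀ d hd t ht hts htt => ?_⟩
    have h0t := ht₀.1.trans ht
    have h1 := (hout K hK0 t h0t _ (hK t₀ ht₀ x₀ hx₀ d hd t ht htt)).1
    have h2 := (hμm t ⟨h0t, hts⟩).1
    rw [le_div_iff₀ hm]
    nlinarith [norm_nonneg (X t₀ x₀ d t)]
  have htop : ∀ t₀, 0 ≤ t₀ → ∀ x₀ d, InMD D d → tmax t₀ x₀ d = ⊤ := by
    intro t₀ h0 x₀ d hd
    have hlt := (hX t₀ h0 x₀ d hd).1
    by_contra hne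
    have hbot : tmax t₀ x₀ d ≠ ⊥ := ne_bot_of_gt hlt
    have hb := (EReal.coe_toReal hne hbot).symm
    set b := (tmax t₀ x₀ d).toReal with hbdef
    have hlt' : t₀ < b := by rw [hb] at hlt; exact_mod_cast hlt
    obtain ⟨M, hM⟩ := hxb t₀ h0 ‖x₀‖ (norm_nonneg _) b (h0.trans hlt'.le)
    refine ext_sol hD hf_cont X tmax hX hXmax hd h0 x₀ b M hb fun t ht => ?_
    exact hM t₀ ⟨h0, le_rfl⟩ x₀ le_rfl d hd t ht.1 ht.2.le (by rw [hb]; exact_mod_cast ht.2)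
  refine ⟨?_, ?_, ?_⟩
  · intro T hT r hr
    obtain ⟨M, hM⟩ := hxb T hT r hr (T + T) (by positivity)
    refine ⟨M, fun t₀ ht₀ h hh x₀ hx₀ d hd => ?_⟩
    have hlt : ((t₀ + h : ℝ) : EReal) < tmax t₀ x₀ d := by
      rw [htop t₀ ht₀.1 x₀ d hd]; exact EReal.coe_lt_top _
    exact ⟨hlt, hM t₀ ht₀ x₀ hx₀ d hd _ (by linarith [hh.1]) (by linarith [hh.2, ht₀.2]) hlt⟩
  · intro ε hε T hT
    constructor
    · obtain ⟨K, hK0, hK⟩ := hC T hT ε hε.le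
      exact ⟨K, fun t₀ ht₀ x₀ hx₀ d hd t ht htt =>
        (hout K hK0 t (ht₀.1.trans ht) _ (hK t₀ ht₀ x₀ hx₀ d hd t ht htt)).2⟩
    · have hη : 0 < a₁ ε := by
        have := ha₁.2.1 self_mem_Ici (show ε ∈ Ici (0:ℝ) from hε.le) hε
        rwa [ha₁.2.2.1] at this
      obtain ⟨T₁, hT₁0, hT₁⟩ := hqt (a₁ ε / 2) (by positivity)
      set S := max T T₁ with hS
      have hTS : T ≤ S := le_max_left _ _
      have hT₁S : T₁ ≤ S := le_max_right _ _
      have hS0 : 0 ≤ S := hT.trans hTS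
      obtain ⟨_, B, _, hB, hβB⟩ := kplus_bounds hβ S hS0
      obtain ⟨γ, hγ0, hγ⟩ := kinf_small ha₂ (a₁ ε / 2) (by positivity)
      obtain ⟨M, hM⟩ := hxb T hT 1 zero_le_one S hS0
      obtain ⟨L₀, hL₀⟩ := hQ3 (Icc 0 S ×ˢ Metric.closedBall 0 (max M 0))
        (isCompact_Icc.prod (isCompact_closedBall _ _))
        (Set.prod_mono Icc_subset_Ici_self (subset_univ _))
      set L := max L₀ 1 with hL
      have hLpos : 0 < L := lt_of_lt_of_le one_pos (le_max_right _ _)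
      have hexp := Real.exp_pos (L * S)
      refine ⟨min 1 (γ / B / Real.exp (L * S)), by positivity, ?_⟩
      intro t₀ ht₀ x₀ hx₀ d hd t ht htt
      have hx1 : ‖x₀‖ ≤ 1 := hx₀.trans (min_le_left _ _)
      have hx2 : ‖x₀‖ * Real.exp (L * S) ≤ γ / B := by
        rw [← le_div_iff₀ hexp]; exact hx₀.trans (min_le_right _ _)
      have hltop : ∀ s : ℝ, (s : EReal) < tmax t₀ x₀ d := fun s => by
        rw [htop t₀ ht₀.1 x₀ d hd]; exact EReal.coe_lt_top _
      obtain ⟨-, hs0, hsc, hse⟩ := hX t₀ ht₀.1 x₀ d hd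
      have ht₀S : t₀ ≤ S := ht₀.2.trans hTS
      have hxc : ContinuousOn (X t₀ x₀ d) (Icc t₀ S) := hsc.mono fun s hs => ⟨hs.1, hltop s⟩
      have hg := gron ht₀S hLpos (c := ‖x₀‖) hxc.norm (by
        intro s hs
        rw [hse s hs.1 (hltop s)]
        refine (norm_add_le _ _).trans ?_
        gcongr
        rw [← intervalIntegral.integral_const_mul]
        have hxc' : ContinuousOn (X t₀ x₀ d) (Icc t₀ s) := hxc.mono (Icc_subset_Icc_right hs.2)
        refine intervalIntegral.norm_integral_le_of_norm_le hs.1 ?_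
          ((continuousOn_const.mul hxc'.norm).intervalIntegrable_of_Icc hs.1)
        refine Eventually.of_forall fun r hr => ?_
        have hr0 : 0 ≤ r := ht₀.1.trans hr.1.le
        have hrS : r ≤ S := hr.2.trans hs.2
        have hMr := hM t₀ ht₀ x₀ hx1 d hd r hr.1.le hrS (hltop r)
        have := hL₀ (d r) (hd.2 r) r (X t₀ x₀ d r) 0
          ⟨⟨hr0, hrS⟩, by simpa using Or.inl hMr⟩ ⟨⟨hr0, hrS⟩, by simp⟩
        rw [hf0 r hr0 _ (hd.2 r), sub_zero, sub_zero] at this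
        refine this.trans ?_
        gcongr
        exact le_max_left _ _)
      have hsm : ∀ s ∈ Icc t₀ S, V s (X t₀ x₀ d s) ≤ a₁ ε / 2 := by
        intro s hs
        have hs0' : 0 ≤ s := ht₀.1.trans hs.1
        have h1 : ‖X t₀ x₀ d s‖ ≤ γ / B := by
          refine (hg s hs).trans (le_trans ?_ hx2)
          gcongr
          linarith [hs.2, ht₀.1]
        refine (hup γ hγ0.le s hs0' _ ?_).trans hγ
        rw [le_div_iff₀ hB] at h1
        have := (hβB s ⟨hs0', hs.2⟩).2
        nlinarith [norm_nonneg (X t₀ x₀ d s)]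
      refine (hout ε hε.le t (ht₀.1.trans ht) _ ?_).2
      rcases le_total t S with h | h
      · have := hsm t ⟨ht, h⟩
        linarith
      · have h1 := hsm S ⟨ht₀S, le_rfl⟩
        have h2 := hv1 t₀ ht₀.1 x₀ d hd S t ht₀S h htt
        have h3 := hT₁ S t hT₁S h
        linarith
  · intro ε hε T hT R hR
    have hη : 0 < a₁ ε := by
      have := ha₁.2.1 self_mem_Ici (show ε ∈ Ici (0:ℝ) from hε.le) hε
      rwa [ha₁.2.2.1] at this
    obtain ⟨T₁, hT₁0, hT₁⟩ := hqt (a₁ ε / 2) (by positivity)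
    set S := max T T₁ with hS
    have hTS : T ≤ S := le_max_left _ _
    have hT₁S : T₁ ≤ S := le_max_right _ _
    have hS0 : 0 ≤ S := hT.trans hTS
    obtain ⟨K, hK0, hK⟩ := hC T hT R hR
    obtain ⟨c, hc0, hc⟩ : ∃ c, 0 < c ∧ ∀ s ∈ Icc (a₁ ε / 2) (a₁ K), c ≤ ρ s := by
      rcases (Icc (a₁ ε / 2) (a₁ K)).eq_empty_or_nonempty with he | hne
      · exact ⟨1, one_pos, fun s hs => by rw [he] at hs; exact hs.elim⟩
      · obtain ⟨u, hu, hu'⟩ := isCompact_Icc.exists_isMinOn hne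
          (hρ.1.mono fun s hs => (half_pos hη).le.trans hs.1)
        exact ⟨ρ u, hρ.2.2.1 u (lt_of_lt_of_le (half_pos hη) hu.1), fun s hs => hu' hs⟩
    have hK1 : 0 ≤ a₁ K := by
      rw [← ha₁.2.2.1]; exact (ha₁.2.1.le_iff_le self_mem_Ici hK0).2 hK0
    set τ := (a₁ K + I + 1) / c with hτ
    have hτ0 : 0 ≤ τ := by positivity
    refine ⟨S + τ, by positivity, ?_⟩
    intro t₀ ht₀ x₀ hx₀ d hd t ht htt
    have ht₀S : t₀ ≤ S := ht₀.2.trans hTS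
    have htS : S + τ ≤ t := by linarith [ht₀.1]
    have hltop : ∀ s : ℝ, (s : EReal) < tmax t₀ x₀ d := fun s => by
      rw [htop t₀ ht₀.1 x₀ d hd]; exact EReal.coe_lt_top _
    obtain ⟨s, hs, hsv⟩ : ∃ s ∈ Icc S (S + τ), V s (X t₀ x₀ d s) ≤ a₁ ε / 2 := by
      by_contra! hcon
      have hSτ : S ≤ S + τ := by linarith
      obtain ⟨i1, i2, h⟩ := hly ht₀.1 x₀ hd ht₀S hSτ (hltop _)
      have h1 := intervalIntegral.integral_mono_on hSτ i1
        ((intervalIntegrable_const (c := -c)).add i2) (fun s hs => by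
        have := hc (V s (X t₀ x₀ d s)) ⟨(hcon s hs).le,
          hK t₀ ht₀ x₀ hx₀ d hd s (ht₀S.trans hs.1) (hltop s)⟩
        linarith)
      rw [intervalIntegral.integral_add intervalIntegrable_const i2,
        intervalIntegral.integral_const, smul_eq_mul] at h1
      have h2 := hI S (S + τ) hS0 hSτ
      have h3 := hK t₀ ht₀ x₀ hx₀ d hd S ht₀S (hltop S)
      have h4 := hVpos (S + τ) (X t₀ x₀ d (S + τ))
      have h5 : τ * c = a₁ K + I + 1 := by rw [hτ]; field_simp
      have h6 : (S + τ - S) * -c = -(τ * c) := by ring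
      linarith
    have hst : s ≤ t := hs.2.trans htS
    refine (hout ε hε.le t (by linarith [hs.1]) _ ?_).2
    have h2 := hv1 t₀ ht₀.1 x₀ d hd s t (ht₀S.trans hs.1) hst htt
    have h3 := hT₁ s t (hT₁S.trans hs.1) hst
    linarith
end
end

section
/- Suppose system (1.1) under hypotheses (H1)-(H3) admits an ORCLF V which satisfies the small-control property with β ≡ 1 and q ≡ 0, i.e. a₁(|(μ(t)x, H(t,x))|) ≤ V(t,x) ≤ a₂(|x|) for all (t,x), and for every (t,x) there exists u ∈ U with |u| ≤ a(γ(t)|x|) and Ψ(t,x,u) ≤ 0. Then there exists a continuous mapping k : [0,∞)×ℝⁿ → U with k(t,0) = 0 for all t ≥ 0, which is C^∞ on [0,∞)×(ℝⁿ∖{0}), such that: (i) for every (t₀,x₀,d) ∈ [0,∞)×ℝⁿ×M_D the solution of the closed-loop system ẋ(t) = f(t, d(t), x(t), k(t, x(t))) with initial condition x(t₀) = x₀ corresponding to d is unique; (ii) the closed-loop system with output Y(t) = H(t, x(t)) is URGAOS. -/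
open Filter Topology MeasureTheory Set

noncomputable section

/-- Hypotheses (H1)-(H3) for the control system (1.1). -/
def Hyp113 {n l k m : ℕ} (D : Set (Euc l)) (U : Set (Euc m))
    (f : ℝ → Euc l → Euc n → Euc m → Euc n) (H : ℝ → Euc n → Euc k) : Prop :=
  -- (H1): continuity and local Lipschitz continuity in (x,u)
  ContinuousOn (fun p : ℝ × Euc l × Euc n × Euc m => f p.1 p.2.1 p.2.2.1 p.2.2.2)
    (Ici 0 ×ˢ D ×ˢ univ ×ˢ U) ∧
  ContinuousOn (fun p : ℝ × Euc n => H p.1 p.2) (Ici 0 ×ˢ univ) ∧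
  (∀ I : Set ℝ, Bornology.IsBounded I → I ⊆ Ici 0 →
    ∀ S : Set (Euc n × Euc m), IsCompact S →
    ∃ L, 0 ≤ L ∧ ∀ t ∈ I, ∀ d ∈ D, ∀ x y : Euc n, ∀ u v : Euc m,
      (x, u) ∈ S → (y, v) ∈ S → u ∈ U → v ∈ U →
      ‖f t d x u - f t d y v‖ ≤ L * ‖x - y‖ + L * ‖u - v‖) ∧
  -- (H2): D compact, U closed convex
  IsCompact D ∧ D.Nonempty ∧ IsClosed U ∧ Convex ℝ U ∧
  -- (H3): f(t,d,0,0) = 0, H(t,0) = 0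
  (∀ t, 0 ≤ t → ∀ d ∈ D, f t d 0 0 = 0) ∧ (∀ t, 0 ≤ t → H t 0 = 0)

/-- The conjunction of all requirements of Definition 2.6 for an ORCLF,
with all the data (comparison functions, Ψ, q, ρ) given explicitly. -/
def ORCLFprop {n l k m : ℕ} (D : Set (Euc l)) (U : Set (Euc m))
    (f : ℝ → Euc l → Euc n → Euc m → Euc n) (H : ℝ → Euc n → Euc k)
    (V : ℝ → Euc n → ℝ) (a₁ a₂ β μ : ℝ → ℝ)
    (Ψ : ℝ → Euc n → Euc m → EReal) (q ρ : ℝ → ℝ) : Prop :=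
  (∀ t x, 0 ≤ V t x) ∧
  LocallyLipschitz (fun p : ℝ × Euc n => V p.1 p.2) ∧
  -- property (i)
  IsKinf a₁ ∧ IsKinf a₂ ∧ IsKplus β ∧ IsKplus μ ∧
  (∀ t, 0 ≤ t → ∀ x : Euc n,
    a₁ (pairNorm (μ t • x) (H t x)) ≤ V t x ∧ V t x ≤ a₂ (β t * ‖x‖)) ∧
  -- property (ii)
  IsClassE q ∧ IsPosDef ρ ∧
  (∀ t x u, Ψ t x u ≠ ⊥) ∧
  (∀ t, 0 ≤ t → Ψ t 0 0 = 0) ∧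
  (∀ u ∈ U, UpperSemicontinuousOn (fun p : ℝ × Euc n => Ψ p.1 p.2 u) (Ici 0 ×ˢ univ)) ∧
  (∀ t, 0 ≤ t → ∀ x : Euc n, (⨅ u : U, Ψ t x u.1) ≤ ((q t : ℝ) : EReal)) ∧
  (∀ t, 0 ≤ t → ∀ x : Euc n, ∀ (p : ℕ) (u : Fin p → Euc m), (∀ i, u i ∈ U) →
    ∀ lam : Fin p → ℝ, (∀ i, 0 ≤ lam i) → (∑ i, lam i) = 1 →
    ∀ d ∈ D, dini0 V t x (f t d x (∑ i, lam i • u i)) ≤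
      ((-ρ (V t x) : ℝ) : EReal) + ⨆ i, Ψ t x (u i))

/-- The "small-control" property of Definition 2.6. -/
def SmallControlProp {n m : ℕ} (U : Set (Euc m))
    (Ψ : ℝ → Euc n → Euc m → EReal) (q : ℝ → ℝ) (a γ : ℝ → ℝ) : Prop :=
  IsKinf a ∧ IsKplus γ ∧
  ∀ t, 0 ≤ t → ∀ x : Euc n, ∃ u ∈ U, ‖u‖ ≤ a (γ t * ‖x‖) ∧ Ψ t x u ≤ ((q t : ℝ) : EReal)

/-- RGAOS of the (closed-loop) system ẋ = F(t,d(t),x) with output Y = H(t,x),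
phrased via the existence of a family of unique maximal solutions that satisfies
robust forward completeness and properties P1, P2 of Definition 2.2. -/
def RGAOScl {n l k : ℕ} (D : Set (Euc l)) (F : ℝ → Euc l → Euc n → Euc n)
    (H : ℝ → Euc n → Euc k) : Prop :=
  ∃ (X : ℝ → Euc n → (ℝ → Euc l) → ℝ → Euc n)
    (tmax : ℝ → Euc n → (ℝ → Euc l) → EReal),
    (∀ t₀ : ℝ, 0 ≤ t₀ → ∀ x₀ d, InMD D d →
      IsSolution F d t₀ x₀ (tmax t₀ x₀ d) (X t₀ x₀ d) ∧
      ∀ tm y, IsSolution F d t₀ x₀ tm y → tm ≤ tmax t₀ x₀ d ∧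
        ∀ t : ℝ, t₀ ≤ t → (t : EReal) < tm → y t = X t₀ x₀ d t) ∧
    (∀ T, 0 ≤ T → ∀ rr, 0 ≤ rr → ∃ M, ∀ t₀ ∈ Icc (0:ℝ) T, ∀ h ∈ Icc (0:ℝ) T,
      ∀ x₀ : Euc n, ‖x₀‖ ≤ rr → ∀ d, InMD D d →
        ((t₀ + h : ℝ) : EReal) < tmax t₀ x₀ d ∧ ‖X t₀ x₀ d (t₀ + h)‖ ≤ M) ∧
    (∀ ε, 0 < ε → ∀ T, 0 ≤ T →
      (∃ M, ∀ t₀ ∈ Icc (0:ℝ) T, ∀ x₀ : Euc n, ‖x₀‖ ≤ ε → ∀ d, InMD D d →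
        ∀ t : ℝ, t₀ ≤ t → (t : EReal) < tmax t₀ x₀ d → ‖H t (X t₀ x₀ d t)‖ ≤ M) ∧
      (∃ δ, 0 < δ ∧ ∀ t₀ ∈ Icc (0:ℝ) T, ∀ x₀ : Euc n, ‖x₀‖ ≤ δ → ∀ d, InMD D d →
        ∀ t : ℝ, t₀ ≤ t → (t : EReal) < tmax t₀ x₀ d → ‖H t (X t₀ x₀ d t)‖ ≤ ε)) ∧
    (∀ ε, 0 < ε → ∀ T, 0 ≤ T → ∀ R, 0 ≤ R → ∃ τ, 0 ≤ τ ∧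
      ∀ t₀ ∈ Icc (0:ℝ) T, ∀ x₀ : Euc n, ‖x₀‖ ≤ R → ∀ d, InMD D d →
        ∀ t : ℝ, t₀ + τ ≤ t → (t : EReal) < tmax t₀ x₀ d → ‖H t (X t₀ x₀ d t)‖ ≤ ε)

/-- URGAOS of the (closed-loop) system ẋ = F(t,d(t),x) with output Y = H(t,x). -/
def URGAOScl {n l k : ℕ} (D : Set (Euc l)) (F : ℝ → Euc l → Euc n → Euc n)
    (H : ℝ → Euc n → Euc k) : Prop :=
  ∃ (X : ℝ → Euc n → (ℝ → Euc l) → ℝ → Euc n)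
    (tmax : ℝ → Euc n → (ℝ → Euc l) → EReal),
    (∀ t₀ : ℝ, 0 ≤ t₀ → ∀ x₀ d, InMD D d →
      IsSolution F d t₀ x₀ (tmax t₀ x₀ d) (X t₀ x₀ d) ∧
      ∀ tm y, IsSolution F d t₀ x₀ tm y → tm ≤ tmax t₀ x₀ d ∧
        ∀ t : ℝ, t₀ ≤ t → (t : EReal) < tm → y t = X t₀ x₀ d t) ∧
    (∀ T, 0 ≤ T → ∀ rr, 0 ≤ rr → ∃ M, ∀ t₀ ∈ Icc (0:ℝ) T, ∀ h ∈ Icc (0:ℝ) T,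
      ∀ x₀ : Euc n, ‖x₀‖ ≤ rr → ∀ d, InMD D d →
        ((t₀ + h : ℝ) : EReal) < tmax t₀ x₀ d ∧ ‖X t₀ x₀ d (t₀ + h)‖ ≤ M) ∧
    (∀ ε, 0 < ε →
      (∃ M, ∀ t₀ : ℝ, 0 ≤ t₀ → ∀ x₀ : Euc n, ‖x₀‖ ≤ ε → ∀ d, InMD D d →
        ∀ t : ℝ, t₀ ≤ t → (t : EReal) < tmax t₀ x₀ d → ‖H t (X t₀ x₀ d t)‖ ≤ M) ∧
      (∃ δ, 0 < δ ∧ ∀ t₀ : ℝ, 0 ≤ t₀ → ∀ x₀ : Euc n, ‖x₀‖ ≤ δ → ∀ d, InMD D d →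
        ∀ t : ℝ, t₀ ≤ t → (t : EReal) < tmax t₀ x₀ d → ‖H t (X t₀ x₀ d t)‖ ≤ ε)) ∧
    (∀ ε, 0 < ε → ∀ R, 0 ≤ R → ∃ τ, 0 ≤ τ ∧
      ∀ t₀ : ℝ, 0 ≤ t₀ → ∀ x₀ : Euc n, ‖x₀‖ ≤ R → ∀ d, InMD D d →
        ∀ t : ℝ, t₀ + τ ≤ t → (t : EReal) < tmax t₀ x₀ d → ‖H t (X t₀ x₀ d t)‖ ≤ ε)

lemma aux_delay {n : ℕ} (t0 T : ℝ) (G : ℝ → Euc n → Euc n) (M : ℝ) (hM0 : 0 ≤ M)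
    (hM : ∀ s x, ‖G s x‖ ≤ M)
    (hmeas : ∀ x : ℝ → Euc n, Continuous x → Measurable (fun s => G s (x s)))
    (x0 : Euc n) (δ : ℝ) (hδ : 0 < δ) :
    ∃ x : ℝ → Euc n, LipschitzWith (Real.toNNReal M) x ∧ x t0 = x0 ∧
      ∀ t ≤ T, x t = x0 + ∫ s in t0..(max t0 (t - δ)), G s (x s) := by
  have hint : ∀ x : ℝ → Euc n, Continuous x → ∀ a b,
      IntervalIntegrable (fun s => G s (x s)) volume a b := by
    intro x hx a b
    refine (intervalIntegrable_const (c := M)).mono_fun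
      (hmeas x hx).aestronglyMeasurable ?_
    refine Eventually.of_forall fun s => ?_
    simpa [abs_of_nonneg hM0] using hM s (x s)
  let Φ : (ℝ → Euc n) → (ℝ → Euc n) := fun x t =>
    x0 + ∫ s in t0..(max t0 (t - δ)), G s (x s)
  have hΦL : ∀ x, Continuous x → LipschitzWith (Real.toNNReal M) (Φ x) := by
    intro x hx
    refine LipschitzWith.of_dist_le_mul fun t t' => ?_
    rw [Real.coe_toNNReal _ hM0, dist_eq_norm]
    have : Φ x t - Φ x t' = ∫ s in (max t0 (t' - δ))..(max t0 (t - δ)), G s (x s) := by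
      simp only [Φ, add_sub_add_left_eq_sub]
      rw [intervalIntegral.integral_interval_sub_left (hint x hx _ _) (hint x hx _ _)]
    rw [this]
    refine (intervalIntegral.norm_integral_le_of_norm_le_const (fun s _ => hM s (x s))).trans ?_
    refine mul_le_mul_of_nonneg_left ?_ hM0
    rw [Real.dist_eq]
    refine (abs_max_sub_max_le_max _ _ _ _).trans ?_
    simp
  let y : ℕ → ℝ → Euc n := fun i => Φ^[i] (fun _ => x0)
  have hys : ∀ i, y (i+1) = Φ (y i) := fun i => Function.iterate_succ_apply' _ _ _
  have hyL : ∀ i, LipschitzWith (Real.toNNReal M) (y i) := by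
    intro i
    induction i with
    | zero => exact LipschitzWith.const' x0
    | succ i ih => rw [hys]; exact hΦL _ ih.continuous
  have hyt : ∀ i, y i t0 = x0 := by
    intro i
    cases i with
    | zero => rfl
    | succ i => rw [hys]; simp [Φ, hδ.le]
  have hyeq : ∀ i : ℕ, ∀ t ≤ t0 + i * δ, y (i+1) t = y i t := by
    intro i
    induction i with
    | zero =>
      intro t ht
      rw [hys]
      have : max t0 (t - δ) = t0 := max_eq_left (by simp at ht; linarith)
      simp only [Φ, this, intervalIntegral.integral_same, add_zero]
      rfl
    | succ i ih =>
      intro t ht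
      rw [hys (i+1)]
      conv_rhs => rw [hys i]
      simp only [Φ]
      congr 1
      refine intervalIntegral.integral_congr fun s hs => ?_
      rw [uIcc_of_le (le_max_left _ _)] at hs
      rw [ih s]
      refine hs.2.trans ?_
      push_cast at ht
      exact max_le (by nlinarith [(Nat.cast_nonneg i : (0:ℝ) ≤ i)]) (by linarith)
  obtain ⟨N, hN⟩ := exists_nat_ge ((T - t0) / δ)
  refine ⟨y N, hyL N, hyt N, fun t ht => ?_⟩
  have h1 : T ≤ t0 + N * δ := by
    rw [div_le_iff₀ hδ] at hN; linarith
  rw [← hyeq N t (ht.trans h1), hys]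

lemma aux_peano {n : ℕ} (t0 T : ℝ) (hT : t0 ≤ T) (G : ℝ → Euc n → Euc n) (M : ℝ)
    (hM : ∀ s x, ‖G s x‖ ≤ M)
    (hmeas : ∀ x : ℝ → Euc n, Continuous x → Measurable (fun s => G s (x s)))
    (hcont : ∀ s, Continuous (G s))
    (x0 : Euc n) :
    ∃ x : ℝ → Euc n, Continuous x ∧ ∀ t ∈ Icc t0 T, x t = x0 + ∫ s in t0..t, G s (x s) := by
  have hM0 : 0 ≤ M := (norm_nonneg _).trans (hM 0 0)
  have hint : ∀ x : ℝ → Euc n, Continuous x → ∀ a b,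
      IntervalIntegrable (fun s => G s (x s)) volume a b := by
    intro x hx a b
    refine (intervalIntegrable_const (c := M)).mono_fun
      (hmeas x hx).aestronglyMeasurable ?_
    refine Eventually.of_forall fun s => ?_
    simpa [abs_of_nonneg hM0] using hM s (x s)
  have hex := fun j : ℕ => aux_delay t0 T G M hM0 hM hmeas x0 (1 / ((j:ℝ)+1)) (by positivity)
  choose y hyL hy0 hyeq using hex
  let Y : ℕ → BoundedContinuousFunction (Icc t0 T) (Euc n) := fun j =>
    BoundedContinuousFunction.mkOfCompact ⟨fun s => y j s, (hyL j).continuous.comp continuous_subtype_val⟩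
  have hcpt : IsCompact (closure (range Y)) := by
    refine BoundedContinuousFunction.arzela_ascoli (Metric.closedBall x0 (M * (T - t0)))
      (isCompact_closedBall _ _) _ ?_ ?_
    · rintro _ s ⟨j, rfl⟩
      change y j s ∈ _
      rw [Metric.mem_closedBall]
      have := (hyL j).dist_le_mul s t0
      rw [hy0, Real.coe_toNNReal _ hM0] at this
      refine this.trans (mul_le_mul_of_nonneg_left ?_ hM0)
      rw [Real.dist_eq, abs_of_nonneg (by linarith [s.2.1])]
      linarith [s.2.2]
    · refine (LipschitzWith.uniformEquicontinuous _ (Real.toNNReal M) ?_).equicontinuous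
      rintro ⟨_, j, rfl⟩
      exact (hyL j).comp (LipschitzWith.subtype_val _) |>.weaken (by simp)
  obtain ⟨Z, -, φ, hφ, hlim⟩ := hcpt.tendsto_subseq (fun j => subset_closure (mem_range_self j))
  let x : ℝ → Euc n := IccExtend hT Z
  have hx : Continuous x := Z.continuous.Icc_extend'
  have hpt : ∀ s ∈ Icc t0 T, Tendsto (fun j => y (φ j) s) atTop (𝓝 (x s)) := by
    intro s hs
    have h1 := ((continuous_eval_const (F := BoundedContinuousFunction (Icc t0 T) (Euc n)) (⟨s, hs⟩ : Icc t0 T)).tendsto Z).comp hlim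
    have : x s = Z ⟨s, hs⟩ := IccExtend_of_mem hT Z hs
    rw [this]
    exact h1
  refine ⟨x, hx, fun t ht => ?_⟩
  have hI : Tendsto (fun j => ∫ s in t0..t, G s (y (φ j) s)) atTop (𝓝 (∫ s in t0..t, G s (x s))) := by
    refine intervalIntegral.tendsto_integral_filter_of_dominated_convergence (fun _ => M) ?_ ?_ ?_ ?_
    · exact Eventually.of_forall fun j => (hmeas _ (hyL _).continuous).aestronglyMeasurable
    · exact Eventually.of_forall fun j => Eventually.of_forall fun s _ => hM _ _
    · exact intervalIntegrable_const
    · refine Eventually.of_forall fun s hs => ?_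
      rw [uIoc_of_le ht.1] at hs
      exact ((hcont s).tendsto _).comp (hpt s ⟨hs.1.le, hs.2.trans ht.2⟩)
  have hD : Tendsto (fun j => y (φ j) t - (x0 + ∫ s in t0..t, G s (y (φ j) s))) atTop (𝓝 0) := by
    refine squeeze_zero_norm (a := fun j => M * (1 / (((φ j : ℕ):ℝ)+1))) ?_ ?_
    · intro j
      rw [hyeq (φ j) t ht.2, add_sub_add_left_eq_sub,
        intervalIntegral.integral_interval_sub_left (hint _ (hyL _).continuous _ _) (hint _ (hyL _).continuous _ _)]
      refine (intervalIntegral.norm_integral_le_of_norm_le_const (fun s _ => hM s _)).trans ?_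
      refine mul_le_mul_of_nonneg_left ?_ hM0
      have hp : (0:ℝ) < 1 / (((φ j : ℕ):ℝ)+1) := by positivity
      have h3 : t - 1 / (((φ j : ℕ):ℝ)+1) ≤ max t0 (t - 1 / (((φ j : ℕ):ℝ)+1)) := le_max_right _ _
      have h4 : max t0 (t - 1 / (((φ j : ℕ):ℝ)+1)) ≤ t := max_le ht.1 (by linarith)
      rw [abs_le]; constructor <;> linarith
    · have := (tendsto_one_div_add_atTop_nhds_zero_nat (𝕜 := ℝ)).comp hφ.tendsto_atTop
      simpa using this.const_mul M
  have h5 := (hpt t ht).sub (hI.const_add x0)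
  have h6 := tendsto_nhds_unique h5 hD
  exact sub_eq_zero.1 h6

/-- solution in integral form on a compact interval -/
def SolI {n l : ℕ} (F : ℝ → Euc l → Euc n → Euc n) (d : ℝ → Euc l)
    (t₀ T : ℝ) (x₀ : Euc n) (x : ℝ → Euc n) : Prop :=
  ContinuousOn x (Icc t₀ T) ∧ ∀ t ∈ Icc t₀ T, x t = x₀ + ∫ s in t₀..t, F s (d s) (x s)

lemma aux_meas {n l : ℕ} (D : Set (Euc l)) (hD : IsCompact D) (F : ℝ → Euc l → Euc n → Euc n)
    (hF : ContinuousOn (fun p : ℝ × Euc l × Euc n => F p.1 p.2.1 p.2.2) (Ici 0 ×ˢ D ×ˢ univ))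
    (d : ℝ → Euc l) (hd : InMD D d) (t0 T : ℝ) (h0 : 0 ≤ t0) (x : ℝ → Euc n)
    (hx : ContinuousOn x (Icc t0 T)) :
    (∃ M, 0 ≤ M ∧ ∀ s ∈ Icc t0 T, ‖F s (d s) (x s)‖ ≤ M) ∧
    IntegrableOn (fun s => F s (d s) (x s)) (Icc t0 T) := by
  have hb : ∃ M, 0 ≤ M ∧ ∀ s ∈ Icc t0 T, ‖F s (d s) (x s)‖ ≤ M := by
    have hK : IsCompact (Icc t0 T ×ˢ D ×ˢ (x '' Icc t0 T)) :=
      isCompact_Icc.prod (hD.prod (isCompact_Icc.image_of_continuousOn hx))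
    obtain ⟨M, hM⟩ := hK.exists_bound_of_continuousOn (hF.mono (by
      rintro ⟨s, e, y⟩ ⟨hs, he, hy⟩
      exact ⟨h0.trans hs.1, he, mem_univ _⟩))
    exact ⟨max M 0, le_max_right _ _, fun s hs => (hM (s, d s, x s) ⟨hs, hd.2 s, mem_image_of_mem _ hs⟩).trans (le_max_left _ _)⟩
  refine ⟨hb, ?_⟩
  obtain ⟨M, -, hM⟩ := hb
  have hm : AEStronglyMeasurable (fun s => F s (d s) (x s)) (volume.restrict (Icc t0 T)) := by
    refine AEMeasurable.aestronglyMeasurable ?_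
    refine aemeasurable_restrict_of_measurable_subtype measurableSet_Icc ?_
    have h1 : Measurable (fun p : (Ici (0:ℝ) ×ˢ D ×ˢ (univ : Set (Euc n)) : Set (ℝ × Euc l × Euc n)) => F p.1.1 p.1.2.1 p.1.2.2) :=
      (continuousOn_iff_continuous_domRestrict.1 hF).measurable
    have h2 : Measurable (fun s : Icc t0 T => (⟨(s.1, d s, x s), h0.trans s.2.1, hd.2 s, mem_univ _⟩ :
        (Ici (0:ℝ) ×ˢ D ×ˢ (univ : Set (Euc n)) : Set (ℝ × Euc l × Euc n)))) := by
      refine Measurable.subtype_mk ?_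
      refine measurable_subtype_coe.prodMk ((hd.1.comp measurable_subtype_coe).prodMk ?_)
      exact (continuousOn_iff_continuous_domRestrict.1 hx).measurable
    exact h1.comp h2
  refine Integrable.of_bound hm M ?_
  exact (ae_restrict_iff' measurableSet_Icc).2 (Eventually.of_forall hM)

lemma aux_dini {n : ℕ} (V : ℝ → Euc n → ℝ) (x : ℝ → Euc n) (t : ℝ) (v : Euc n)
    (hx : HasDerivAt x v t) (hV : DifferentiableAt ℝ (fun s => V s (x s)) t) :
    ((deriv (fun s => V s (x s)) t : ℝ) : EReal) ≤ dini0 V t (x t) v := by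
  have h1 : Tendsto (fun h : ℝ => (h, h⁻¹ • (x (t + h) - x t))) (𝓝[>] 0) ((𝓝[>] (0:ℝ)) ×ˢ 𝓝 v) := by
    refine tendsto_id.prodMk ?_
    exact hx.tendsto_slope_zero.mono_left (nhdsWithin_mono _ (fun y hy => (ne_of_gt hy)))
  have h2 : Tendsto (fun h : ℝ => (((V (t + h) (x (t + h)) - V t (x t)) / h : ℝ) : EReal)) (𝓝[>] 0)
      (𝓝 ((deriv (fun s => V s (x s)) t : ℝ) : EReal)) := by
    refine (continuous_coe_real_ereal.tendsto _).comp ?_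
    have := hV.hasDerivAt.tendsto_slope_zero.mono_left (nhdsWithin_mono _ (fun y (hy : y ∈ Ioi (0:ℝ)) => (ne_of_gt hy)))
    refine this.congr fun h => ?_
    simp [div_eq_inv_mul]
  rw [← h2.limsup_eq]
  unfold dini0
  have h3 : limsup (fun h : ℝ => (((V (t + h) (x (t + h)) - V t (x t)) / h : ℝ) : EReal)) (𝓝[>] 0)
    = limsup (fun p : ℝ × Euc n => (((V (t + p.1) (x t + p.1 • p.2) - V t (x t)) / p.1 : ℝ) : EReal))
      (map (fun h : ℝ => (h, h⁻¹ • (x (t + h) - x t))) (𝓝[>] 0)) := by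
    rw [← limsup_comp]
    refine limsup_congr ?_
    filter_upwards [self_mem_nhdsWithin] with h hh
    have hne : h ≠ 0 := ne_of_gt hh
    simp [smul_smul, hne]
  rw [h3]
  exact limsup_le_limsup_of_le h1

lemma aux_decay {n l : ℕ} (D : Set (Euc l)) (hD : IsCompact D) (F : ℝ → Euc l → Euc n → Euc n)
    (hF : ContinuousOn (fun p : ℝ × Euc l × Euc n => F p.1 p.2.1 p.2.2) (Ici 0 ×ˢ D ×ˢ univ))
    (V : ℝ → Euc n → ℝ) (hV : LocallyLipschitz (fun p : ℝ × Euc n => V p.1 p.2)) (σ : ℝ → ℝ)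
    (hdec : ∀ t, 0 ≤ t → ∀ x, ∀ e ∈ D, dini0 V t x (F t e x) ≤ ((-σ (V t x) : ℝ) : EReal))
    (d : ℝ → Euc l) (hd : InMD D d) (t0 T : ℝ) (h0 : 0 ≤ t0) (x0 : Euc n) (x : ℝ → Euc n)
    (hx : SolI F d t0 T x0 x) (s t : ℝ) (hs : t0 ≤ s) (hst : s ≤ t) (ht : t ≤ T) (c : ℝ)
    (hc : ∀ r ∈ Icc s t, c ≤ σ (V r (x r))) :
    V t (x t) - V s (x s) ≤ - c * (t - s) := by
  obtain ⟨hxc, hxe⟩ := hx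
  obtain ⟨⟨M, hM0, hM⟩, hI⟩ := aux_meas D hD F hF d hd t0 T h0 x hxc
  have hle : t0 ≤ T := hs.trans (hst.trans ht)
  have hII : IntervalIntegrable (fun s => F s (d s) (x s)) volume t0 T :=
    (intervalIntegrable_iff_integrableOn_Icc_of_le hle).2 hI
  have hxL : LipschitzOnWith (Real.toNNReal M) x (Icc t0 T) := by
    refine LipschitzOnWith.of_dist_le_mul fun a ha b hb => ?_
    rw [Real.coe_toNNReal _ hM0, dist_eq_norm, hxe a ha, hxe b hb, add_sub_add_left_eq_sub,
      intervalIntegral.integral_interval_sub_left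
       (hII.mono_set (uIcc_subset_uIcc left_mem_uIcc (by rwa [uIcc_of_le hle])))
       (hII.mono_set (uIcc_subset_uIcc left_mem_uIcc (by rwa [uIcc_of_le hle]))), Real.dist_eq]
    refine intervalIntegral.norm_integral_le_of_norm_le_const fun r hr => hM r ?_
    have := uIcc_subset_Icc hb ha
    exact this (uIoc_subset_uIcc hr)
  have hvL : ∃ K, LipschitzOnWith K (fun r => V r (x r)) (Icc t0 T) := by
    have hg : LipschitzOnWith (max 1 (Real.toNNReal M)) (fun r => (r, x r)) (Icc t0 T) :=
      LipschitzWith.id.lipschitzOnWith.prodMk hxL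
    have hcp : IsCompact ((fun r => (r, x r)) '' Icc t0 T) :=
      isCompact_Icc.image_of_continuousOn hg.continuousOn
    obtain ⟨K, hK⟩ := (hV.locallyLipschitzOn).exists_lipschitzOnWith_of_compact hcp
    exact ⟨_, hK.comp hg (mapsTo_image _ _)⟩
  obtain ⟨K, hK⟩ := hvL
  have hac : AbsolutelyContinuousOnInterval (fun r => V r (x r)) s t := by
    refine (hK.mono ?_).absolutelyContinuousOnInterval
    rw [uIcc_of_le hst]
    exact Icc_subset_Icc hs ht
  rw [← hac.integral_deriv_eq_sub]
  have : ∫ r in s..t, deriv (fun r => V r (x r)) r ≤ ∫ r in s..t, (-c) := by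
    refine intervalIntegral.integral_mono_ae_restrict hst hac.intervalIntegrable_deriv intervalIntegrable_const ?_
    rw [EventuallyLE, ae_restrict_iff' measurableSet_Icc]
    have hne1 : ∀ᵐ r : ℝ, r ≠ t0 := by simp [ae_iff, measure_singleton]
    have hne2 : ∀ᵐ r : ℝ, r ≠ T := by simp [ae_iff, measure_singleton]
    filter_upwards [hII.ae_hasDerivAt_integral, hac.ae_differentiableAt, hne1, hne2] with r h1 h2 h3 h4 hr
    have hrT : r ∈ Icc t0 T := ⟨hs.trans hr.1, hr.2.trans ht⟩
    have h5 : HasDerivAt x (F r (d r) (x r)) r := by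
      have := (h1 (by rwa [uIcc_of_le hle]) t0 left_mem_uIcc).const_add x0
      refine this.congr_of_eventuallyEq ?_
      have : Icc t0 T ∈ 𝓝 r := Icc_mem_nhds (lt_of_le_of_ne hrT.1 h3.symm) (lt_of_le_of_ne hrT.2 h4)
      filter_upwards [this] with a ha using hxe a ha
    have h6 := (aux_dini V x r _ h5 (h2 (by rwa [uIcc_of_le hst]))).trans
      (hdec r (h0.trans hrT.1) (x r) (d r) (hd.2 r))
    have h7 := EReal.coe_le_coe_iff.1 h6
    linarith [hc r hr]
  refine this.trans (le_of_eq ?_)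
  simp
  ring

lemma aux_restart {n l : ℕ} (D : Set (Euc l)) (hD : IsCompact D) (F : ℝ → Euc l → Euc n → Euc n)
    (hF : ContinuousOn (fun p : ℝ × Euc l × Euc n => F p.1 p.2.1 p.2.2) (Ici 0 ×ˢ D ×ˢ univ))
    (d : ℝ → Euc l) (hd : InMD D d) (t0 T : ℝ) (h0 : 0 ≤ t0) (x0 : Euc n) (x : ℝ → Euc n)
    (hx : SolI F d t0 T x0 x) (s t : ℝ) (hs : t0 ≤ s) (hst : s ≤ t) (ht : t ≤ T) :
    IntervalIntegrable (fun s => F s (d s) (x s)) volume s t ∧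
    x t = x s + ∫ r in s..t, F r (d r) (x r) := by
  obtain ⟨hxc, hxe⟩ := hx
  obtain ⟨-, hI⟩ := aux_meas D hD F hF d hd t0 T h0 x hxc
  have hle : t0 ≤ T := hs.trans (hst.trans ht)
  have hII : ∀ a b, t0 ≤ a → a ≤ b → b ≤ T →
      IntervalIntegrable (fun s => F s (d s) (x s)) volume a b := fun a b ha hab hb =>
    (intervalIntegrable_iff_integrableOn_Icc_of_le hab).2 (hI.mono_set (Icc_subset_Icc ha hb))
  refine ⟨hII s t hs hst ht, ?_⟩
  rw [hxe t ⟨hs.trans hst, ht⟩, hxe s ⟨hs, hst.trans ht⟩, add_assoc,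
    intervalIntegral.integral_add_adjacent_intervals (hII t0 s le_rfl hs (hst.trans ht)) (hII s t hs hst ht)]

lemma aux_unique {n l : ℕ} (D : Set (Euc l)) (hD : IsCompact D) (F : ℝ → Euc l → Euc n → Euc n)
    (hF : ContinuousOn (fun p : ℝ × Euc l × Euc n => F p.1 p.2.1 p.2.2) (Ici 0 ×ˢ D ×ˢ univ))
    (hloc : ∀ t, 0 ≤ t → ∀ x : Euc n, x ≠ 0 → ∃ L, 0 ≤ L ∧ ∃ δ, 0 < δ ∧ ∀ s ∈ Icc t (t + δ), ∀ e ∈ D,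
      ∀ y ∈ Metric.closedBall x δ, ∀ z ∈ Metric.closedBall x δ, ‖F s e y - F s e z‖ ≤ L * ‖y - z‖)
    (V : ℝ → Euc n → ℝ) (hV : LocallyLipschitz (fun p : ℝ × Euc n => V p.1 p.2)) (σ : ℝ → ℝ)
    (hσ : ∀ t x, 0 ≤ σ (V t x))
    (hV0 : ∀ t, 0 ≤ t → V t 0 = 0) (hVp : ∀ t, 0 ≤ t → ∀ x, V t x ≤ 0 → x = 0)
    (hdec : ∀ t, 0 ≤ t → ∀ x, ∀ e ∈ D, dini0 V t x (F t e x) ≤ ((-σ (V t x) : ℝ) : EReal))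
    (d : ℝ → Euc l) (hd : InMD D d) (t0 T : ℝ) (h0 : 0 ≤ t0) (x0 : Euc n) (x y : ℝ → Euc n)
    (hx : SolI F d t0 T x0 x) (hy : SolI F d t0 T x0 y) : ∀ t ∈ Icc t0 T, x t = y t := by
  have hzero : ∀ z, SolI F d t0 T x0 z → ∀ r ∈ Icc t0 T, z r = 0 → ∀ t ∈ Icc r T, z t = 0 := by
    intro z hz r hr hzr t ht
    have := aux_decay D hD F hF V hV σ hdec d hd t0 T h0 x0 z hz r t hr.1 ht.1 ht.2 0 (fun _ _ => hσ _ _)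
    rw [hzr, hV0 r (h0.trans hr.1)] at this
    exact hVp t (h0.trans (hr.1.trans ht.1)) _ (by linarith)
  rcases lt_or_ge T t0 with hT | hT
  · intro t ht; exact absurd (ht.1.trans ht.2) (not_le.2 hT)
  change Icc t0 T ⊆ {t | x t = y t}
  refine IsClosed.Icc_subset_of_forall_mem_nhdsWithin ?_ ?_ ?_
  · have := (hx.1.sub hy.1).preimage_isClosed_of_isClosed isClosed_Icc (isClosed_singleton (x := (0 : Euc n)))
    convert this using 1
    ext t
    simp [sub_eq_zero, and_comm]
  · change x t0 = y t0
    rw [hx.2 t0 ⟨le_rfl, hT⟩, hy.2 t0 ⟨le_rfl, hT⟩]; simp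
  · rintro r ⟨hr, hr1, hr2⟩
    have hrr : x r = y r := hr
    by_cases hxr : x r = 0
    · filter_upwards [Icc_mem_nhdsGT hr2] with t ht
      change x t = y t
      rw [hzero x hx r ⟨hr1, hr2.le⟩ hxr t ht, hzero y hy r ⟨hr1, hr2.le⟩ (hrr ▸ hxr) t ht]
    · obtain ⟨L, hL, δ, hδ, hlip⟩ := hloc r (h0.trans hr1) (x r) hxr
      have hmem : Icc t0 T ∈ 𝓝[≥] r := mem_of_superset (Icc_mem_nhdsGE hr2) (Icc_subset_Icc hr1 le_rfl)
      have hcx : ∀ᶠ t in 𝓝[≥] r, x t ∈ Metric.closedBall (x r) δ :=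
        ((hx.1 r ⟨hr1, hr2.le⟩).mono_of_mem_nhdsWithin hmem) (Metric.closedBall_mem_nhds _ hδ)
      have hcy : ∀ᶠ t in 𝓝[≥] r, y t ∈ Metric.closedBall (x r) δ := by
        rw [hrr]
        exact ((hy.1 r ⟨hr1, hr2.le⟩).mono_of_mem_nhdsWithin hmem) (Metric.closedBall_mem_nhds _ hδ)
      have hδ' : 0 < min δ (1 / (2 * (L + 1))) := by positivity
      have hc3 : ∀ᶠ t in 𝓝[≥] r, t ∈ Icc r (r + min δ (1 / (2 * (L + 1)))) :=
        Icc_mem_nhdsGE (by linarith)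
      obtain ⟨η, hη, hsub⟩ := (mem_nhdsGE_iff_exists_Icc_subset).1 (hcx.and (hcy.and (hc3.and hmem)))
      have hη' : r < η := hη
      have hkey : ∀ t ∈ Icc r η, x t = y t := by
        have hrη : η ∈ Icc r η := ⟨hη'.le, le_rfl⟩
        have hηT : Icc r η ⊆ Icc t0 T := fun t ht => (hsub ht).2.2.2
        have hgc : ContinuousOn (fun t => ‖x t - y t‖) (Icc r η) :=
          ((hx.1.mono hηT).sub (hy.1.mono hηT)).norm
        obtain ⟨s0, hs0, hmax⟩ := isCompact_Icc.exists_isMaxOn ⟨η, hrη⟩ hgc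
        have hm : ∀ t ∈ Icc r η, ‖x t - y t‖ ≤ ‖x s0 - y s0‖ := fun t ht => hmax ht
        have h1 := aux_restart D hD F hF d hd t0 T h0 x0 x hx r s0 hr1 hs0.1 (hηT hs0).2
        have h2 := aux_restart D hD F hF d hd t0 T h0 x0 y hy r s0 hr1 hs0.1 (hηT hs0).2
        have h3 : ‖x s0 - y s0‖ ≤ (L * ‖x s0 - y s0‖) * |s0 - r| := by
          conv_lhs => rw [h1.2, h2.2, hrr, add_sub_add_left_eq_sub, ← intervalIntegral.integral_sub h1.1 h2.1]
          refine intervalIntegral.norm_integral_le_of_norm_le_const fun q hq => ?_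
          rw [uIoc_of_le hs0.1] at hq
          have hq' : q ∈ Icc r η := ⟨hq.1.le, hq.2.trans hs0.2⟩
          have hq2 := hsub hq'
          refine (hlip q ⟨hq2.2.2.1.1, hq2.2.2.1.2.trans (by linarith [min_le_left δ (1 / (2 * (L + 1)))])⟩ _ (hd.2 q) _ hq2.1 _ hq2.2.1).trans ?_
          exact mul_le_mul_of_nonneg_left (hm q hq') hL
        have h4 : |s0 - r| ≤ 1 / (2 * (L + 1)) := by
          rw [abs_of_nonneg (by linarith [hs0.1])]
          have := (hsub hs0).2.2.1.2
          linarith [min_le_right δ (1 / (2 * (L + 1)))]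
        have h5 : L * (1 / (2 * (L + 1))) ≤ 1 / 2 := by
          rw [mul_one_div, div_le_div_iff₀ (by positivity) (by norm_num)]; linarith
        have h6 : ‖x s0 - y s0‖ ≤ 0 := by
          have hn := norm_nonneg (x s0 - y s0)
          have : (L * ‖x s0 - y s0‖) * |s0 - r| ≤ (L * ‖x s0 - y s0‖) * (1 / (2 * (L + 1))) :=
            mul_le_mul_of_nonneg_left h4 (by positivity)
          nlinarith
        intro t ht
        have := (hm t ht).trans h6
        exact sub_eq_zero.1 (norm_le_zero_iff.1 this)
      filter_upwards [Icc_mem_nhdsGT hη'] with t ht using hkey t ht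

lemma aux_exist {n l : ℕ} (D : Set (Euc l)) (hD : IsCompact D) (F : ℝ → Euc l → Euc n → Euc n)
    (hF : ContinuousOn (fun p : ℝ × Euc l × Euc n => F p.1 p.2.1 p.2.2) (Ici 0 ×ˢ D ×ˢ univ))
    (V : ℝ → Euc n → ℝ) (hV : LocallyLipschitz (fun p : ℝ × Euc n => V p.1 p.2)) (σ : ℝ → ℝ)
    (hσ : ∀ t x, 0 ≤ σ (V t x))
    (hdec : ∀ t, 0 ≤ t → ∀ x, ∀ e ∈ D, dini0 V t x (F t e x) ≤ ((-σ (V t x) : ℝ) : EReal))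
    (d : ℝ → Euc l) (hd : InMD D d) (t0 T : ℝ) (h0 : 0 ≤ t0) (hT : t0 ≤ T) (x0 : Euc n)
    (R : ℝ) (hR : ∀ t ∈ Icc t0 T, ∀ x, V t x ≤ V t0 x0 → ‖x‖ < R) :
    ∃ x, SolI F d t0 T x0 x := by
  let c : Euc n → ℝ := fun x => max 0 (min 1 (R + 1 - ‖x‖))
  have hcc : Continuous c := by fun_prop
  have hc0 : ∀ x, R + 1 ≤ ‖x‖ → c x = 0 := fun x hx => by
    simp only [c]; rw [max_eq_left]; exact (min_le_right _ _).trans (by linarith)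
  have hc1 : ∀ x, ‖x‖ ≤ R → c x = 1 := fun x hx => by
    simp only [c]; rw [min_eq_left (by linarith)]; norm_num
  have hcb : ∀ x, |c x| ≤ 1 := fun x => by
    rw [abs_of_nonneg (le_max_left _ _)]; exact max_le (by norm_num) (min_le_left _ _)
  let p : ℝ → ℝ := fun s => projIcc t0 T hT s
  have hp : Continuous p := continuous_subtype_val.comp continuous_projIcc
  have hpm : ∀ s, p s ∈ Icc t0 T := fun s => (projIcc t0 T hT s).2
  have hpe : ∀ s ∈ Icc t0 T, p s = s := fun s hs => by simp only [p]; rw [projIcc_of_mem hT hs]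
  let G : ℝ → Euc n → Euc n := fun s x => c x • F (p s) (d s) x
  have hK : IsCompact (Icc t0 T ×ˢ D ×ˢ (Metric.closedBall (0 : Euc n) (R + 1))) :=
      isCompact_Icc.prod (hD.prod (isCompact_closedBall _ _))
  obtain ⟨M, hM⟩ := hK.exists_bound_of_continuousOn (hF.mono (by
      rintro ⟨s, e, y⟩ ⟨hs, he, hy⟩
      exact ⟨h0.trans hs.1, he, mem_univ _⟩))
  have hMG : ∀ s x, ‖G s x‖ ≤ max M 0 := by
    intro s x
    rcases le_or_gt (R + 1) ‖x‖ with h | h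
    · simp [G, hc0 x h]
    · simp only [G, norm_smul, Real.norm_eq_abs]
      have := hM (p s, d s, x) ⟨hpm s, hd.2 s, by simpa using h.le⟩
      simp only at this
      calc |c x| * ‖F (p s) (d s) x‖ ≤ 1 * ‖F (p s) (d s) x‖ :=
            mul_le_mul_of_nonneg_right (hcb x) (norm_nonneg _)
        _ ≤ _ := by rw [one_mul]; exact this.trans (le_max_left _ _)
  have hmeas : ∀ x : ℝ → Euc n, Continuous x → Measurable (fun s => G s (x s)) := by
    intro x hx
    have h1 : Measurable (fun p : (Ici (0:ℝ) ×ˢ D ×ˢ (univ : Set (Euc n)) : Set (ℝ × Euc l × Euc n)) => F p.1.1 p.1.2.1 p.1.2.2) :=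
      (continuousOn_iff_continuous_domRestrict.1 hF).measurable
    have h2 : Measurable (fun s : ℝ => (⟨(p s, d s, x s), h0.trans (hpm s).1, hd.2 s, mem_univ _⟩ :
        (Ici (0:ℝ) ×ˢ D ×ˢ (univ : Set (Euc n)) : Set (ℝ × Euc l × Euc n)))) := by
      refine Measurable.subtype_mk ?_
      exact hp.measurable.prodMk (hd.1.prodMk hx.measurable)
    exact (hcc.comp hx).measurable.smul (h1.comp h2)
  have hcont : ∀ s, Continuous (G s) := by
    intro s
    refine hcc.smul ?_
    refine hF.comp_continuous (f := fun x => (p s, d s, x)) (by fun_prop) ?_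
    intro x
    exact ⟨h0.trans (hpm s).1, hd.2 s, mem_univ _⟩
  obtain ⟨x, hx, hxe⟩ := aux_peano t0 T hT G _ hMG hmeas hcont x0
  have hsol : ∀ t ∈ Icc t0 T, (∀ s ∈ Ioo t0 t, ‖x s‖ < R) → SolI F d t0 t x0 x := by
    intro t ht hb
    refine ⟨hx.continuousOn, fun r hr => ?_⟩
    rw [hxe r ⟨hr.1, hr.2.trans ht.2⟩]
    congr 1
    refine intervalIntegral.integral_congr_ae ?_
    have hne2 : ∀ᵐ q : ℝ, q ≠ r := by simp [ae_iff, measure_singleton]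
    filter_upwards [hne2] with q hq1 hq
    rw [uIoc_of_le hr.1] at hq
    have hq' : q ∈ Ioo t0 t := ⟨hq.1, (lt_of_le_of_ne hq.2 hq1).trans_le hr.2⟩
    simp only [G]
    rw [hc1 _ (hb q hq').le, one_smul, hpe q ⟨hq'.1.le, hq'.2.le.trans ht.2⟩]
  have hx0 : x t0 = x0 := by rw [hxe t0 ⟨le_rfl, hT⟩]; simp
  have hall : ∀ t ∈ Icc t0 T, ‖x t‖ < R := by
    by_contra hcon
    push Not at hcon
    have hcp : IsCompact (Icc t0 T ∩ {t | R ≤ ‖x t‖}) :=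
      isCompact_Icc.inter_right (isClosed_le continuous_const hx.norm)
    obtain ⟨t, ⟨ht, htR⟩, hmin⟩ := hcp.exists_isLeast (by
      obtain ⟨t, h1, h2⟩ := hcon; exact ⟨t, h1, h2⟩)
    have hs := hsol t ht (fun s hs => by
      by_contra h
      have := hmin ⟨⟨hs.1.le, hs.2.le.trans ht.2⟩, not_lt.1 h⟩
      linarith [hs.2])
    have := aux_decay D hD F hF V hV σ hdec d hd t0 t h0 x0 x hs t0 t le_rfl ht.1 le_rfl 0 (fun _ _ => hσ _ _)
    rw [hx0] at this
    have h2 := hR t ht (x t) (by linarith)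
    have h3 : R ≤ ‖x t‖ := htR
    linarith
  exact ⟨x, hsol T ⟨hT, le_rfl⟩ fun s hs => hall s ⟨hs.1.le, hs.2.le⟩⟩

lemma aux_kinf {a : ℝ → ℝ} (ha : IsKinf a) (C : ℝ) : ∃ B, 0 < B ∧ ∀ s, 0 ≤ s → a s ≤ C → s < B := by
  obtain ⟨hc, hm, h0, ht⟩ := ha
  obtain ⟨B, hB0, hB⟩ := ((eventually_gt_atTop 0).and (ht.eventually_gt_atTop C)).exists
  refine ⟨B, hB0, fun s hs hsC => ?_⟩
  by_contra h
  have := hm.monotoneOn (mem_Ici.2 hB0.le) (mem_Ici.2 hs) (not_lt.1 h)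
  linarith

lemma aux_pair1 {n k : ℕ} (a : Euc n) (b : Euc k) : ‖a‖ ≤ pairNorm a b :=
  Real.le_sqrt_of_sq_le (by nlinarith [sq_nonneg ‖b‖])

lemma aux_pair2 {n k : ℕ} (a : Euc n) (b : Euc k) : ‖b‖ ≤ pairNorm a b :=
  Real.le_sqrt_of_sq_le (by nlinarith [sq_nonneg ‖a‖])

lemma SolI.mono {n l : ℕ} {F : ℝ → Euc l → Euc n → Euc n} {d : ℝ → Euc l}
    {t₀ T T' : ℝ} {x₀ : Euc n} {x : ℝ → Euc n} (h : SolI F d t₀ T x₀ x) (hT : T' ≤ T) :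
    SolI F d t₀ T' x₀ x :=
  ⟨h.1.mono (Icc_subset_Icc le_rfl hT), fun t ht => h.2 t ⟨ht.1, ht.2.trans hT⟩⟩

lemma SolI.congr {n l : ℕ} {F : ℝ → Euc l → Euc n → Euc n} {d : ℝ → Euc l}
    {t₀ T : ℝ} {x₀ : Euc n} {x y : ℝ → Euc n} (h : SolI F d t₀ T x₀ x)
    (he : ∀ t ∈ Icc t₀ T, y t = x t) : SolI F d t₀ T x₀ y := by
  refine ⟨h.1.congr he, fun t ht => ?_⟩
  rw [he t ht, h.2 t ht]
  congr 1
  refine intervalIntegral.integral_congr fun s hs => ?_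
  rw [uIcc_of_le ht.1] at hs
  simp only [he s ⟨hs.1, hs.2.trans ht.2⟩]

lemma SolI.ofIs {n l : ℕ} {F : ℝ → Euc l → Euc n → Euc n} {d : ℝ → Euc l}
    {t₀ T : ℝ} {x₀ : Euc n} {x : ℝ → Euc n} {tm : EReal} (h : IsSolution F d t₀ x₀ tm x)
    (hT : (T : EReal) < tm) : SolI F d t₀ T x₀ x := by
  obtain ⟨-, -, h3, h4⟩ := h
  refine ⟨h3.mono fun t ht => ⟨ht.1, lt_of_le_of_lt (EReal.coe_le_coe_iff.2 ht.2) hT⟩, fun t ht => ?_⟩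
  exact h4 t ht.1 (lt_of_le_of_lt (EReal.coe_le_coe_iff.2 ht.2) hT)

lemma aux_cl {n l k : ℕ} (D : Set (Euc l)) (hD : IsCompact D) (F : ℝ → Euc l → Euc n → Euc n)
    (H : ℝ → Euc n → Euc k)
    (hF : ContinuousOn (fun p : ℝ × Euc l × Euc n => F p.1 p.2.1 p.2.2) (Ici 0 ×ˢ D ×ˢ univ))
    (hloc : ∀ t, 0 ≤ t → ∀ x : Euc n, x ≠ 0 → ∃ L, 0 ≤ L ∧ ∃ δ, 0 < δ ∧ ∀ s ∈ Icc t (t + δ), ∀ e ∈ D,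
      ∀ y ∈ Metric.closedBall x δ, ∀ z ∈ Metric.closedBall x δ, ‖F s e y - F s e z‖ ≤ L * ‖y - z‖)
    (V : ℝ → Euc n → ℝ) (hV : LocallyLipschitz (fun p : ℝ × Euc n => V p.1 p.2)) (σ : ℝ → ℝ)
    (hVnn : ∀ t x, 0 ≤ V t x)
    (hσc : ContinuousOn σ (Ici 0)) (hσp : ∀ s, 0 < s → 0 < σ s) (hσn : ∀ s, 0 ≤ s → 0 ≤ σ s)
    (a₁ a₂ μ : ℝ → ℝ) (ha₁ : IsKinf a₁) (ha₂ : IsKinf a₂) (hμ : IsKplus μ)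
    (hs1 : ∀ t, 0 ≤ t → ∀ x : Euc n, a₁ (pairNorm (μ t • x) (H t x)) ≤ V t x)
    (hs2 : ∀ t, 0 ≤ t → ∀ x : Euc n, V t x ≤ a₂ ‖x‖)
    (hdec : ∀ t, 0 ≤ t → ∀ x, ∀ e ∈ D, dini0 V t x (F t e x) ≤ ((-σ (V t x) : ℝ) : EReal)) :
    (∀ t₀ : ℝ, 0 ≤ t₀ → ∀ x₀ : Euc n, ∀ d, InMD D d →
        ∀ tm₁ tm₂ y₁ y₂, IsSolution F d t₀ x₀ tm₁ y₁ → IsSolution F d t₀ x₀ tm₂ y₂ →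
          ∀ t : ℝ, t₀ ≤ t → (t : EReal) < tm₁ → (t : EReal) < tm₂ → y₁ t = y₂ t) ∧
    URGAOScl D F H := by
  have hσ : ∀ t x, 0 ≤ σ (V t x) := fun t x => hσn _ (hVnn t x)
  have hpn : ∀ t x, 0 ≤ pairNorm (μ t • x) (H t x) := fun t x => Real.sqrt_nonneg _
  have ha₁0 : a₁ 0 = 0 := ha₁.2.2.1
  have hV0 : ∀ t, 0 ≤ t → V t 0 = 0 := fun t ht => by
    have := hs2 t ht 0
    rw [norm_zero, ha₂.2.2.1] at this
    exact le_antisymm this (hVnn _ _)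
  have hVp : ∀ t, 0 ≤ t → ∀ x, V t x ≤ 0 → x = 0 := by
    intro t ht x hx
    by_contra hne
    have h1 : 0 < pairNorm (μ t • x) (H t x) := by
      refine lt_of_lt_of_le ?_ (aux_pair1 _ _)
      rw [norm_pos_iff]
      exact smul_ne_zero (hμ.2 t ht).ne' hne
    have := ha₁.2.1 (mem_Ici.2 le_rfl) (mem_Ici.2 h1.le) h1
    linarith [hs1 t ht x]
  have huniq := fun (d : ℝ → Euc l) (hd : InMD D d) (t0 T : ℝ) (h0 : 0 ≤ t0) x0 x y =>
    aux_unique D hD F hF hloc V hV σ hσ hV0 hVp hdec d hd t0 T h0 x0 x y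
  have hu : (∀ t₀ : ℝ, 0 ≤ t₀ → ∀ x₀ : Euc n, ∀ d, InMD D d →
        ∀ tm₁ tm₂ y₁ y₂, IsSolution F d t₀ x₀ tm₁ y₁ → IsSolution F d t₀ x₀ tm₂ y₂ →
          ∀ t : ℝ, t₀ ≤ t → (t : EReal) < tm₁ → (t : EReal) < tm₂ → y₁ t = y₂ t) := by
    intro t0 h0 x0 d hd tm₁ tm₂ y₁ y₂ h1 h2 t ht ht1 ht2
    exact huniq d hd t0 t h0 x0 y₁ y₂ (SolI.ofIs h1 ht1) (SolI.ofIs h2 ht2) t ⟨ht, le_rfl⟩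
  refine ⟨hu, ?_⟩
  -- uniform bound
  have hbd : ∀ T r, 0 ≤ T → ∃ R, ∀ t ∈ Icc 0 T, ∀ x, V t x ≤ a₂ r → ‖x‖ < R := by
    intro T r hT
    obtain ⟨B, hB0, hB⟩ := aux_kinf ha₁ (a₂ r)
    obtain ⟨s, hs, hmin⟩ := isCompact_Icc.exists_isMinOn (nonempty_Icc.2 hT) (hμ.1.mono (Icc_subset_Ici_self : Icc 0 T ⊆ Ici 0))
    have hms := hμ.2 s hs.1
    refine ⟨B / μ s, fun t ht x hx => ?_⟩
    have h1 := hB _ (hpn t x) ((hs1 t ht.1 x).trans hx)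
    have h2 := (aux_pair1 (μ t • x) (H t x)).trans_lt h1
    rw [norm_smul, Real.norm_eq_abs, abs_of_pos (hμ.2 t ht.1)] at h2
    have h3 : μ s ≤ μ t := hmin ht
    rw [lt_div_iff₀ hms]
    nlinarith [norm_nonneg x]
  have ha₂m : ∀ {r s : ℝ}, 0 ≤ r → r ≤ s → a₂ r ≤ a₂ s := fun hr hrs =>
    ha₂.2.1.monotoneOn (mem_Ici.2 hr) (mem_Ici.2 (hr.trans hrs)) hrs
  have hglob : ∀ t0 (x0 : Euc n) (d : ℝ → Euc l), ∃ x, 0 ≤ t0 → InMD D d → ∀ T, SolI F d t0 T x0 x := by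
    intro t0 x0 d
    by_cases hh : 0 ≤ t0 ∧ InMD D d
    swap
    · exact ⟨fun _ => 0, fun h1 h2 => absurd ⟨h1, h2⟩ hh⟩
    obtain ⟨h0, hd⟩ := hh
    have hN : ∀ N : ℕ, ∃ x, SolI F d t0 (t0 + N) x0 x := by
      intro N
      obtain ⟨R, hR⟩ := hbd (t0 + N) ‖x0‖ (by positivity)
      exact aux_exist D hD F hF V hV σ hσ hdec d hd t0 (t0 + N) h0 (by simp) x0 R
        (fun t ht x hx => hR t ⟨h0.trans ht.1, ht.2⟩ x (hx.trans (hs2 t0 h0 x0)))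
    choose y hy using hN
    refine ⟨fun t => y ⌈t - t0⌉₊ t, fun _ _ T => ?_⟩
    obtain ⟨N, hN⟩ := exists_nat_ge (T - t0)
    refine SolI.mono (T := t0 + N) ?_ (by linarith)
    refine (hy N).congr fun t ht => ?_
    have h1 : t - t0 ≤ ⌈t - t0⌉₊ := Nat.le_ceil _
    have h2 : ⌈t - t0⌉₊ ≤ N := Nat.ceil_le.2 (by linarith [ht.2])
    have h3 : (⌈t - t0⌉₊ : ℝ) ≤ N := by exact_mod_cast h2
    exact huniq d hd t0 (t0 + ⌈t - t0⌉₊) h0 x0 _ _ (hy _) ((hy N).mono (by linarith)) t ⟨ht.1, by linarith⟩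
  choose X hX using hglob
  have hX0 : ∀ t0 x0 d, 0 ≤ t0 → InMD D d → X t0 x0 d t0 = x0 := by
    intro t0 x0 d h0 hd
    rw [(hX t0 x0 d h0 hd t0).2 t0 ⟨le_rfl, le_rfl⟩]; simp
  have hXs : ∀ t0 x0 d, 0 ≤ t0 → InMD D d → IsSolution F d t0 x0 ⊤ (X t0 x0 d) := by
    intro t0 x0 d h0 hd
    refine ⟨EReal.coe_lt_top _, hX0 t0 x0 d h0 hd, ?_, fun t ht _ => (hX t0 x0 d h0 hd t).2 t ⟨ht, le_rfl⟩⟩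
    have : {t : ℝ | t0 ≤ t ∧ (t : EReal) < ⊤} = Ici t0 := by
      ext t; simp
    rw [this]
    intro t ht
    have h1 : t ∈ Icc t0 (t + 1) := ⟨ht, by linarith⟩
    refine ((hX t0 x0 d h0 hd (t + 1)).1 t h1).mono_of_mem_nhdsWithin ?_
    have h2 : Iic (t + 1) ∈ 𝓝 t := Iic_mem_nhds (by linarith)
    filter_upwards [self_mem_nhdsWithin, mem_nhdsWithin_of_mem_nhds h2] with s hs1 hs2 using ⟨hs1, hs2⟩
  have hdecay := fun (t0 : ℝ) (x0 : Euc n) (d : ℝ → Euc l) (h0 : 0 ≤ t0) (hd : InMD D d) (s t : ℝ) (hs : t0 ≤ s) (hst : s ≤ t) =>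
    aux_decay D hD F hF V hV σ hdec d hd t0 t h0 x0 _ (hX t0 x0 d h0 hd t) s t hs hst le_rfl
  have hVm : ∀ t0 x0 d, 0 ≤ t0 → InMD D d → ∀ s t, t0 ≤ s → s ≤ t →
      V t (X t0 x0 d t) ≤ V s (X t0 x0 d s) := by
    intro t0 x0 d h0 hd s t hs hst
    have := hdecay t0 x0 d h0 hd s t hs hst 0 (fun _ _ => hσ _ _)
    linarith
  have hVb : ∀ t0 x0 d, 0 ≤ t0 → InMD D d → ∀ t, t0 ≤ t → V t (X t0 x0 d t) ≤ a₂ ‖x0‖ := by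
    intro t0 x0 d h0 hd t ht
    have := hVm t0 x0 d h0 hd t0 t le_rfl ht
    rw [hX0 t0 x0 d h0 hd] at this
    exact this.trans (hs2 t0 h0 x0)
  have hout : ∀ ε, 0 < ε → ∀ t, 0 ≤ t → ∀ x, V t x ≤ a₁ ε → ‖H t x‖ ≤ ε := by
    intro ε hε t ht x hx
    by_contra h
    have h1 : ε < pairNorm (μ t • x) (H t x) := (not_le.1 h).trans_le (aux_pair2 _ _)
    have := ha₁.2.1 (mem_Ici.2 hε.le) (mem_Ici.2 (hpn t x)) h1
    linarith [hs1 t ht x]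
  refine ⟨X, fun _ _ _ => ⊤, ?_, ?_, ?_, ?_⟩
  · intro t0 h0 x0 d hd
    refine ⟨hXs t0 x0 d h0 hd, fun tm y hy => ⟨le_top, fun t ht htm => ?_⟩⟩
    exact hu t0 h0 x0 d hd tm ⊤ y _ hy (hXs t0 x0 d h0 hd) t ht htm (EReal.coe_lt_top _)
  · intro T hT r hr
    obtain ⟨R, hR⟩ := hbd (T + T) r (by linarith)
    refine ⟨R, fun t0 ht0 h hh x0 hx0 d hd => ⟨EReal.coe_lt_top _, ?_⟩⟩
    refine (hR (t0 + h) ⟨by linarith [ht0.1, hh.1], by linarith [ht0.2, hh.2]⟩ _ ?_).le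
    exact (hVb t0 x0 d ht0.1 hd (t0 + h) (by linarith [hh.1])).trans (ha₂m (norm_nonneg _) hx0)
  · intro ε hε
    constructor
    · obtain ⟨B, hB0, hB⟩ := aux_kinf ha₁ (a₂ ε)
      refine ⟨B, fun t0 h0 x0 hx0 d hd t ht _ => ?_⟩
      refine (aux_pair2 (μ t • X t0 x0 d t) _).trans (hB _ (hpn _ _) ?_).le
      exact (hs1 t (h0.trans ht) _).trans ((hVb t0 x0 d h0 hd t ht).trans (ha₂m (norm_nonneg _) hx0))
    · have h1 : 0 < a₁ ε := by
        have := ha₁.2.1 (mem_Ici.2 le_rfl) (mem_Ici.2 hε.le) hε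
        linarith
      have h2 : ∀ᶠ s in 𝓝[≥] (0:ℝ), a₂ s < a₁ ε := by
        have := ha₂.1 0 (mem_Ici.2 le_rfl)
        refine this (Iio_mem_nhds ?_)
        rw [ha₂.2.2.1]; exact h1
      obtain ⟨δ, hδ, hsub⟩ := mem_nhdsGE_iff_exists_Icc_subset.1 h2
      have hδ' : 0 < δ := hδ
      refine ⟨δ, hδ', fun t0 h0 x0 hx0 d hd t ht _ => ?_⟩
      refine hout ε hε t (h0.trans ht) _ ((hVb t0 x0 d h0 hd t ht).trans ?_)
      exact le_of_lt (hsub ⟨norm_nonneg _, hx0⟩)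
  · intro ε hε R hR
    have h1 : 0 < a₁ ε := by
      have := ha₁.2.1 (mem_Ici.2 le_rfl) (mem_Ici.2 hε.le) hε
      linarith
    by_cases hcase : a₂ R < a₁ ε
    · refine ⟨0, le_rfl, fun t0 h0 x0 hx0 d hd t ht _ => ?_⟩
      have ht' : t0 ≤ t := by linarith
      exact hout ε hε t (h0.trans ht') _ ((hVb t0 x0 d h0 hd t ht').trans ((ha₂m (norm_nonneg _) hx0).trans hcase.le))
    · push Not at hcase
      obtain ⟨s, hs, hmin⟩ := isCompact_Icc.exists_isMinOn (nonempty_Icc.2 hcase)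
        (hσc.mono (fun s hs => mem_Ici.2 (h1.le.trans hs.1) : Icc (a₁ ε) (a₂ R) ⊆ Ici 0))
      have hcp : 0 < σ s := hσp s (h1.trans_le hs.1)
      have ha₂p : 0 < a₂ R := h1.trans_le hcase
      refine ⟨a₂ R / σ s, by positivity, fun t0 h0 x0 hx0 d hd t ht _ => ?_⟩
      have hτ : 0 < a₂ R / σ s := by positivity
      have ht' : t0 ≤ t := by linarith
      refine hout ε hε t (h0.trans ht') _ ?_
      by_contra hcon
      push Not at hcon
      have hc : ∀ r ∈ Icc t0 t, σ s ≤ σ (V r (X t0 x0 d r)) := by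
        intro r hr
        refine hmin ⟨?_, ?_⟩
        · exact hcon.le.trans (hVm t0 x0 d h0 hd r t hr.1 hr.2)
        · exact (hVb t0 x0 d h0 hd r hr.1).trans (ha₂m (norm_nonneg _) hx0)
      have h3 := hdecay t0 x0 d h0 hd t0 t le_rfl ht' (σ s) hc
      have h4 := (hVb t0 x0 d h0 hd t0 le_rfl).trans (ha₂m (norm_nonneg _) hx0)
      have h5 : a₂ R ≤ σ s * (t - t0) := by
        have : a₂ R / σ s ≤ t - t0 := by linarith
        rw [div_le_iff₀ hcp] at this
        linarith
      linarith

open scoped ContDiff Manifold in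
lemma aux_sel {n m : ℕ} (t : ℝ × Euc n → Set (Euc m)) (ht : ∀ p, Convex ℝ (t p))
    (Hloc : ∀ p : ℝ × Euc n, p.2 ≠ 0 → ∃ c, ∀ᶠ q in 𝓝 p, c ∈ t q) :
    ∃ g : ℝ × Euc n → Euc m, (∀ p : ℝ × Euc n, p.2 ≠ 0 → ContDiffAt ℝ (⊤ : ℕ∞) g p) ∧
      ∀ p : ℝ × Euc n, p.2 ≠ 0 → g p ∈ t p := by
  let O : TopologicalSpace.Opens (ℝ × Euc n) :=
    ⟨{p | p.2 ≠ 0}, isOpen_ne_fun continuous_snd continuous_const⟩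
  haveI : SigmaCompactSpace O := by
    haveI : LocallyCompactSpace O := O.isOpen.locallyCompactSpace
    infer_instance
  obtain ⟨g0, hg0⟩ := exists_contMDiffMap_forall_mem_convex_of_local_const (n := (⊤ : ℕ∞))
    (M := O) (F := Euc m) 𝓘(ℝ, ℝ × Euc n) (t := fun p => t p.1) (fun p => ht p.1) (by
      intro p
      obtain ⟨c, hc⟩ := Hloc p.1 p.2
      exact ⟨c, continuous_subtype_val.continuousAt.eventually hc⟩)
  classical
  let g : ℝ × Euc n → Euc m := fun p => if h : p ∈ O then g0 ⟨p, h⟩ else 0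
  have hg : ∀ p : O, g p.1 = g0 p := fun p => by
    simp [g]
  refine ⟨g, fun p hp => ?_, fun p hp => ?_⟩
  · have h1 : ContMDiffAt 𝓘(ℝ, ℝ × Euc n) 𝓘(ℝ, Euc m) ((⊤ : ℕ∞) : WithTop ℕ∞) (fun q : O => g q.1) ⟨p, hp⟩ := by
      have : (fun q : O => g q.1) = g0 := funext hg
      rw [this]
      exact g0.contMDiff _
    exact (contMDiffAt_subtype_iff.1 h1).contDiffAt
  · have := hg ⟨p, hp⟩
    change g p = _ at this
    rw [this]
    exact hg0 ⟨p, hp⟩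

lemma aux_hull {m : ℕ} (S : Set (Euc m)) (v : Euc m) (hv : v ∈ convexHull ℝ S) :
    ∃ (p : ℕ) (u : Fin p → Euc m) (lam : Fin p → ℝ), (∀ i, u i ∈ S) ∧ (∀ i, 0 ≤ lam i) ∧
      ∑ i, lam i = 1 ∧ ∑ i, lam i • u i = v := by
  obtain ⟨ι, _, w, z, hw, hw1, hz, hs⟩ := mem_convexHull_iff_exists_fintype.1 hv
  let e := Fintype.equivFin ι
  refine ⟨Fintype.card ι, z ∘ e.symm, w ∘ e.symm, fun i => hz _, fun i => hw _, ?_, ?_⟩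
  · rw [← hw1]; exact e.symm.sum_comp w
  · rw [← hs]; exact e.symm.sum_comp (fun i => w i • z i)

/-- Theorem 2.9: if system (1.1) admits an ORCLF satisfying the small-control property
with β ≡ 1 and q ≡ 0, then there is a continuous feedback, smooth away from x = 0 and
vanishing at x = 0, such that the closed-loop solutions are unique and the closed-loop
system is URGAOS. -/
theorem stmt4 {n l k m : ℕ} (D : Set (Euc l)) (U : Set (Euc m))
    (f : ℝ → Euc l → Euc n → Euc m → Euc n) (H : ℝ → Euc n → Euc k)
    (hH : Hyp113 D U f H)
    (V : ℝ → Euc n → ℝ) (a₁ a₂ μ : ℝ → ℝ) (Ψ : ℝ → Euc n → Euc m → EReal)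
    (ρ : ℝ → ℝ) (a γ : ℝ → ℝ)
    (hORCLF : ORCLFprop D U f H V a₁ a₂ (fun _ => 1) μ Ψ (fun _ => 0) ρ)
    (hSC : SmallControlProp U Ψ (fun _ => 0) a γ) :
    ∃ kf : ℝ → Euc n → Euc m,
      (∀ t x, kf t x ∈ U) ∧
      ContinuousOn (fun p : ℝ × Euc n => kf p.1 p.2) (Ici 0 ×ˢ univ) ∧
      (∀ t, 0 ≤ t → kf t 0 = 0) ∧
      ContDiffOn ℝ (⊤ : ℕ∞) (fun p : ℝ × Euc n => kf p.1 p.2)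
        (Ici 0 ×ˢ {x : Euc n | x ≠ 0}) ∧
      -- (i): uniqueness of the closed-loop solutions
      (∀ t₀ : ℝ, 0 ≤ t₀ → ∀ x₀ : Euc n, ∀ d, InMD D d →
        ∀ tm₁ tm₂ y₁ y₂,
          IsSolution (fun t d x => f t d x (kf t x)) d t₀ x₀ tm₁ y₁ →
          IsSolution (fun t d x => f t d x (kf t x)) d t₀ x₀ tm₂ y₂ →
          ∀ t : ℝ, t₀ ≤ t → (t : EReal) < tm₁ → (t : EReal) < tm₂ → y₁ t = y₂ t) ∧
      -- (ii): the closed-loop system is URGAOS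
      URGAOScl D (fun t d x => f t d x (kf t x)) H := by
  obtain ⟨hfc, hHc, hfL, hDc, hDne, hUc, hUconv, hf0, hH0⟩ := hH
  obtain ⟨hVnn, hVL, ha₁, ha₂, -, hμ, hsand, -, hρ, hΨbot, hΨ0, hΨusc, -, hdin⟩ := hORCLF
  obtain ⟨ha, hγ, hsc⟩ := hSC
  obtain ⟨hρc, hρ0, hρp, hρn⟩ := hρ
  have hVcont : Continuous (fun p : ℝ × Euc n => V p.1 p.2) := hVL.continuous
  have h0U : (0 : Euc m) ∈ U := by
    obtain ⟨u, hu, hu1, -⟩ := hsc 0 le_rfl 0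
    rw [norm_zero, mul_zero, ha.2.2.1] at hu1
    rwa [norm_le_zero_iff.1 hu1] at hu
  have hs1 : ∀ t, 0 ≤ t → ∀ x : Euc n, a₁ (pairNorm (μ t • x) (H t x)) ≤ V t x :=
    fun t ht x => (hsand t ht x).1
  have hs2 : ∀ t, 0 ≤ t → ∀ x : Euc n, V t x ≤ a₂ ‖x‖ := fun t ht x => by
    have := (hsand t ht x).2
    simpa using this
  have hVpos : ∀ t, 0 ≤ t → ∀ x, x ≠ 0 → 0 < V t x := by
    intro t ht x hne
    have h1 : 0 < pairNorm (μ t • x) (H t x) := by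
      refine lt_of_lt_of_le ?_ (aux_pair1 _ _)
      rw [norm_pos_iff]
      exact smul_ne_zero (hμ.2 t ht).ne' hne
    have := ha₁.2.1 (mem_Ici.2 le_rfl) (mem_Ici.2 h1.le) h1
    rw [ha₁.2.2.1] at this
    linarith [hs1 t ht x]
  let π : ℝ × Euc n → ℝ × Euc n := fun q => (max q.1 0, q.2)
  have hπ : Continuous π := by fun_prop
  have hπm : ∀ q, π q ∈ (Ici (0:ℝ) ×ˢ (univ : Set (Euc n))) := fun q => ⟨mem_Ici.2 (le_max_right q.1 0), mem_univ _⟩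
  let b : ℝ × Euc n → ℝ := fun q => a (γ (max q.1 0) * ‖q.2‖) + ‖q.2‖
  have hbc : Continuous b := by
    have h1 : Continuous (fun q : ℝ × Euc n => γ (max q.1 0)) :=
      hγ.1.comp_continuous (by fun_prop) (fun q => mem_Ici.2 (le_max_right q.1 0))
    have h2 : Continuous (fun q : ℝ × Euc n => a (γ (max q.1 0) * ‖q.2‖)) :=
      ha.1.comp_continuous (h1.mul continuous_snd.norm)
        (fun q => mul_nonneg (hγ.2 _ (le_max_right _ _)).le (norm_nonneg _))
    exact h2.add continuous_snd.norm
  let S : ℝ × Euc n → Set (Euc m) := fun q =>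
    {u | u ∈ U ∧ ‖u‖ ≤ b q ∧ Ψ (π q).1 (π q).2 u ≤ ((ρ (V (π q).1 (π q).2) / 2 : ℝ) : EReal)}
  have hρV : Continuous (fun q : ℝ × Euc n => ρ (V (π q).1 (π q).2)) :=
    hρc.comp_continuous (hVcont.comp hπ) (fun q => hVnn _ _)
  obtain ⟨g, hgs, hgm⟩ := aux_sel (fun q => convexHull ℝ (S q)) (fun q => convex_convexHull ℝ _) (by
    intro p hp
    obtain ⟨u, hu, hu1, hu2⟩ := hsc (max p.1 0) (le_max_right _ _) p.2
    refine ⟨u, ?_⟩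
    have hpos : 0 < ρ (V (π p).1 (π p).2) := hρp _ (hVpos _ (le_max_right _ _) _ hp)
    have e1 : ∀ᶠ q in 𝓝 p, ‖u‖ < b q := by
      refine hbc.continuousAt.eventually (lt_mem_nhds ?_)
      have : 0 < ‖p.2‖ := norm_pos_iff.2 hp
      simp only [b]; linarith
    have e2 : ∀ᶠ q in 𝓝 p, Ψ (π q).1 (π q).2 u < ((ρ (V (π p).1 (π p).2) / 4 : ℝ) : EReal) := by
      have h1 : Tendsto π (𝓝 p) (𝓝[Ici (0:ℝ) ×ˢ (univ : Set (Euc n))] (π p)) :=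
        tendsto_nhdsWithin_iff.2 ⟨hπ.continuousAt, Eventually.of_forall hπm⟩
      refine h1.eventually (hΨusc u hu (π p) (hπm p) _ ?_)
      refine lt_of_le_of_lt hu2 ?_
      exact EReal.coe_lt_coe_iff.2 (by positivity)
    have e3 : ∀ᶠ q in 𝓝 p, ρ (V (π p).1 (π p).2) / 2 < ρ (V (π q).1 (π q).2) :=
      hρV.continuousAt.eventually (lt_mem_nhds (by simp only; linarith))
    filter_upwards [e1, e2, e3] with q h1 h2 h3
    refine subset_convexHull ℝ _ ⟨hu, h1.le, h2.le.trans ?_⟩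
    exact EReal.coe_le_coe_iff.2 (by linarith))
  classical
  let kf : ℝ → Euc n → Euc m := fun t x => if x = 0 then 0 else g (t, x)
  have hk0 : ∀ t, kf t 0 = 0 := fun t => by simp [kf]
  have hkU : ∀ t x, kf t x ∈ U := by
    intro t x
    by_cases hx : x = 0
    · simp [kf, hx, h0U]
    · simp only [kf, hx, if_false]
      exact convexHull_min (fun u hu => hu.1) hUconv (hgm (t, x) hx)
  have hkb : ∀ q : ℝ × Euc n, ‖kf q.1 q.2‖ ≤ b q := by
    intro q
    by_cases hx : q.2 = 0
    · simp [kf, hx, b, ha.2.2.1]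
    · simp only [kf, hx, if_false]
      have : convexHull ℝ (S q) ⊆ Metric.closedBall 0 (b q) :=
        convexHull_min (fun u hu => by simpa using hu.2.1) (convex_closedBall _ _)
      simpa using this (hgm q hx)
  have hks : ∀ q : ℝ × Euc n, q.2 ≠ 0 → ContDiffAt ℝ (⊤ : ℕ∞) (fun p : ℝ × Euc n => kf p.1 p.2) q := by
    intro q hq
    refine (hgs q hq).congr_of_eventuallyEq ?_
    have : ∀ᶠ p : ℝ × Euc n in 𝓝 q, p.2 ≠ 0 := continuous_snd.continuousAt.eventually_ne hq
    filter_upwards [this] with p hp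
    simp [kf, hp]
  have hkc : Continuous (fun p : ℝ × Euc n => kf p.1 p.2) := by
    rw [continuous_iff_continuousAt]
    intro q
    by_cases hq : q.2 = 0
    · have h1 : kf q.1 q.2 = 0 := by rw [hq, hk0]
      have h2 : b q = 0 := by simp [b, hq, ha.2.2.1]
      change Tendsto _ _ (𝓝 (kf q.1 q.2))
      rw [h1]
      refine squeeze_zero_norm hkb ?_
      rw [← h2]
      exact hbc.continuousAt
    · exact (hks q hq).continuousAt
  refine ⟨kf, hkU, hkc.continuousOn, fun t _ => hk0 t, fun q hq => (hks q hq.2).contDiffWithinAt, ?_⟩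
  refine aux_cl D hDc (fun t d x => f t d x (kf t x)) H ?_ ?_ V hVL (fun s => ρ s / 2) hVnn
    (hρc.div_const 2) (fun s hs => half_pos (hρp s hs)) (fun s hs => div_nonneg (hρn s hs) zero_le_two) a₁ a₂ μ ha₁ ha₂ hμ hs1 hs2 ?_
  · refine hfc.comp (f := fun p : ℝ × Euc l × Euc n => (p.1, p.2.1, p.2.2, kf p.1 p.2.2)) ?_ ?_
    · have : Continuous (fun p : ℝ × Euc l × Euc n => kf p.1 p.2.2) :=
        hkc.comp (f := fun p : ℝ × Euc l × Euc n => (p.1, p.2.2)) (by fun_prop)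
      exact Continuous.continuousOn (by fun_prop)
    · rintro ⟨s, e, x⟩ ⟨h1, h2, -⟩
      exact ⟨h1, h2, mem_univ _, hkU _ _⟩
  · intro t ht x hx
    obtain ⟨K, N, hN, hK⟩ := ((hks (t, x) hx).of_le (m := 1) (by exact_mod_cast le_top)).exists_lipschitzOnWith
    obtain ⟨δ, hδ, hsub⟩ := Metric.nhds_basis_closedBall.mem_iff.1 hN
    obtain ⟨C, hC⟩ := (isCompact_closedBall (t, x) δ).exists_bound_of_continuousOn hkc.continuousOn
    obtain ⟨L, hL, hLip⟩ := hfL (Icc t (t + δ)) (Metric.isBounded_Icc _ _) (fun s hs => ht.trans hs.1)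
      (Metric.closedBall x δ ×ˢ Metric.closedBall 0 C) ((isCompact_closedBall _ _).prod (isCompact_closedBall _ _))
    refine ⟨L + L * K, by positivity, δ, hδ, fun s hs e he y hy z hz => ?_⟩
    have hmem : ∀ w ∈ Metric.closedBall x δ, (s, w) ∈ Metric.closedBall (t, x) δ := by
      intro w hw
      rw [Metric.mem_closedBall, Prod.dist_eq]
      refine max_le ?_ hw
      rw [Real.dist_eq, abs_of_nonneg (by linarith [hs.1])]
      linarith [hs.2]
    have h1 := hLip s hs e he y z (kf s y) (kf s z) ⟨hy, by simpa using hC _ (hmem y hy)⟩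
      ⟨hz, by simpa using hC _ (hmem z hz)⟩ (hkU _ _) (hkU _ _)
    have h2 := hK.dist_le_mul _ (hsub (hmem y hy)) _ (hsub (hmem z hz))
    have h3 : dist ((s, y) : ℝ × Euc n) (s, z) = ‖y - z‖ := by
      rw [Prod.dist_eq]; simp [dist_eq_norm]
    rw [h3, dist_eq_norm] at h2
    refine h1.trans ?_
    have := mul_le_mul_of_nonneg_left h2 hL
    simp only at this
    nlinarith
  · intro t ht x e he
    have key : ∀ (p : ℕ) (u : Fin p → Euc m), (∀ i, u i ∈ U) → (∀ i, Ψ t x (u i) ≤ ((ρ (V t x) / 2 : ℝ) : EReal)) →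
        ∀ lam : Fin p → ℝ, (∀ i, 0 ≤ lam i) → (∑ i, lam i) = 1 → ∑ i, lam i • u i = kf t x →
        dini0 V t x (f t e x (kf t x)) ≤ ((-(ρ (V t x) / 2) : ℝ) : EReal) := by
      intro p u hu hΨ lam hl hl1 hs
      have h1 := hdin t ht x p u hu lam hl hl1 e he
      rw [hs] at h1
      refine h1.trans ((add_le_add_right (iSup_le hΨ) _).trans (le_of_eq ?_))
      rw [← EReal.coe_add]
      congr 1
      ring
    by_cases hx : x = 0
    · subst hx
      refine key 1 (fun _ => 0) (fun _ => h0U) (fun _ => ?_) (fun _ => 1) (fun _ => zero_le_one) (by simp) (by simp [hk0])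
      rw [hΨ0 t ht, ← EReal.coe_zero]
      exact EReal.coe_le_coe_iff.2 (div_nonneg (hρn _ (hVnn _ _)) zero_le_two)
    · obtain ⟨p, u, lam, hu, hl, hl1, hs⟩ := aux_hull _ _ (hgm (t, x) hx)
      have hπt : π (t, x) = (t, x) := by simp [π, ht]
      refine key p u (fun i => (hu i).1) (fun i => ?_) lam hl hl1 (by simp [kf, hx, hs])
      have := (hu i).2.2
      rwa [hπt] at this
end
end

section
/- Consider system (1.1) under hypotheses (H1)-(H3) and let V : [0,∞)×ℝⁿ → [0,∞) be a C¹ function. For (t,x,u) ∈ [0,∞)×ℝⁿ×U define 𝒰(t,x,u) := the closure of the convex hull of { v ∈ U : sup_{d∈D} ∇ₓV(t,x)·f(t,d,x,v) ≤ sup_{d∈D} ∇ₓV(t,x)·f(t,d,x,u) }, and, given q ∈ ℰ and a continuous positive definite ρ, define 𝒰̃(t,x) := { v ∈ U : ∂V/∂t(t,x) + sup_{d∈D} ∇ₓV(t,x)·f(t,d,x,v) ≤ −ρ(V(t,x)) + q(t) }. Assume: (i) for every (t,x) there exists u ∈ U with 𝒰(t,x,u) ⊆ 𝒰̃(t,x)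 ≠ ∅; (ii) for each fixed u ∈ U the map (t,x) ↦ sup{ sup_{d∈D} ∇ₓV(t,x)·f(t,d,x,v) : v ∈ 𝒰(t,x,u) } is upper semicontinuous. Then the function Ψ(t,x,u) := ρ(V(t,x)) + ∂V/∂t(t,x) + sup{ sup_{d∈D} ∇ₓV(t,x)·f(t,d,x,v) : v ∈ 𝒰(t,x,u) } satisfies: inf_{u∈U} Ψ(t,x,u) ≤ q(t) for all (t,x), and for every finite {u₁,…,u_p} ⊂ U and λᵢ ∈ [0,1] with Σλᵢ = 1: ∂V/∂t(t,x) + sup_{d∈D} ∇ₓV(t,x)·f(t,d,x, Σᵢλᵢuᵢ) ≤ −ρ(V(t,x)) + maxᵢ Ψ(t,x,uᵢ) for all (t,x); that is, property (ii) of the definition of an ORCLF holds with this Ψ. -/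
open Filter Topology MeasureTheory Set

noncomputable section

section CLFderivs

variable {n l m : ℕ}

/-- ∂V/∂t(t,x), computed as a derivative within [0,∞)×ℝⁿ. -/
def DtV (W : ℝ × Euc n → ℝ) (t : ℝ) (x : Euc n) : ℝ :=
  fderivWithin ℝ W (Ici 0 ×ˢ univ) (t, x) (1, 0)

/-- ∇ₓV(t,x)·v, computed as a derivative within [0,∞)×ℝⁿ. -/
def DxV (W : ℝ × Euc n → ℝ) (t : ℝ) (x : Euc n) (v : Euc n) : ℝ :=
  fderivWithin ℝ W (Ici 0 ×ˢ univ) (t, x) (0, v)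

/-- sup_{d∈D} ∇ₓV(t,x)·f(t,d,x,v), in the extended reals. -/
def supD (D : Set (Euc l)) (f : ℝ → Euc l → Euc n → Euc m → Euc n)
    (W : ℝ × Euc n → ℝ) (t : ℝ) (x : Euc n) (v : Euc m) : EReal :=
  ⨆ d : D, ((DxV W t x (f t d.1 x v) : ℝ) : EReal)

/-- 𝒰(t,x,u) := cl co { v ∈ U : sup_{d∈D} ∇ₓV·f(t,d,x,v) ≤ sup_{d∈D} ∇ₓV·f(t,d,x,u) }. -/
def Uset (D : Set (Euc l)) (U : Set (Euc m)) (f : ℝ → Euc l → Euc n → Euc m → Euc n)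
    (W : ℝ × Euc n → ℝ) (t : ℝ) (x : Euc n) (u : Euc m) : Set (Euc m) :=
  closure (convexHull ℝ {v : Euc m | v ∈ U ∧ supD D f W t x v ≤ supD D f W t x u})

/-- 𝒰̃(t,x) := { v ∈ U : ∂V/∂t + sup_{d∈D} ∇ₓV·f(t,d,x,v) ≤ −ρ(V(t,x)) + q(t) }. -/
def Utilde (D : Set (Euc l)) (U : Set (Euc m)) (f : ℝ → Euc l → Euc n → Euc m → Euc n)
    (W : ℝ × Euc n → ℝ) (q ρ : ℝ → ℝ) (t : ℝ) (x : Euc n) : Set (Euc m) :=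
  {v : Euc m | v ∈ U ∧ ((DtV W t x : ℝ) : EReal) + supD D f W t x v ≤
    ((-ρ (W (t, x)) + q t : ℝ) : EReal)}

/-- Ψ(t,x,u) := ρ(V(t,x)) + ∂V/∂t(t,x) + sup{ sup_{d∈D} ∇ₓV·f(t,d,x,v) : v ∈ 𝒰(t,x,u) }. -/
def PsiU (D : Set (Euc l)) (U : Set (Euc m)) (f : ℝ → Euc l → Euc n → Euc m → Euc n)
    (W : ℝ × Euc n → ℝ) (ρ : ℝ → ℝ) (t : ℝ) (x : Euc n) (u : Euc m) : EReal :=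
  ((ρ (W (t, x)) + DtV W t x : ℝ) : EReal) +
    ⨆ v : (Uset D U f W t x u), supD D f W t x v.1

end CLFderivs

/-- Lemma 3.2: if for every (t,x) there is u ∈ U with 𝒰(t,x,u) ⊆ 𝒰̃(t,x) ≠ ∅, and the map
(t,x) ↦ sup{sup_{d∈D} ∇ₓV·f(t,d,x,v) : v ∈ 𝒰(t,x,u)} is upper semicontinuous for each u,
then Ψ(t,x,u) := ρ(V(t,x)) + ∂V/∂t + sup{...} satisfies property (ii) of Definition 2.6. -/
theorem stmt6 {n l k m : ℕ} (D : Set (Euc l)) (U : Set (Euc m))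
    (f : ℝ → Euc l → Euc n → Euc m → Euc n) (H : ℝ → Euc n → Euc k)
    (hH : Hyp113 D U f H)
    (W : ℝ × Euc n → ℝ) (hW : ContDiffOn ℝ 1 W (Ici 0 ×ˢ univ))
    (hWpos : ∀ p : ℝ × Euc n, 0 ≤ W p)
    (q ρ : ℝ → ℝ) (hq : IsClassE q) (hρ : IsPosDef ρ)
    -- hypothesis (i)
    (hi : ∀ t : ℝ, 0 ≤ t → ∀ x : Euc n, ∃ u ∈ U,
      Uset D U f W t x u ⊆ Utilde D U f W q ρ t x ∧ (Utilde D U f W q ρ t x).Nonempty)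
    -- hypothesis (ii)
    (hii : ∀ u ∈ U, UpperSemicontinuousOn
      (fun p : ℝ × Euc n => ⨆ v : (Uset D U f W p.1 p.2 u), supD D f W p.1 p.2 v.1)
      (Ici 0 ×ˢ univ)) :
    -- conclusion: property (ii) of Definition 2.6 holds with Ψ = PsiU
    (∀ t : ℝ, 0 ≤ t → ∀ x : Euc n,
      (⨅ u : U, PsiU D U f W ρ t x u.1) ≤ ((q t : ℝ) : EReal)) ∧
    (∀ t : ℝ, 0 ≤ t → ∀ x : Euc n, ∀ (p : ℕ) (u : Fin p → Euc m), (∀ i, u i ∈ U) →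
      ∀ lam : Fin p → ℝ, (∀ i, 0 ≤ lam i) → (∑ i, lam i) = 1 →
        ((DtV W t x : ℝ) : EReal) + supD D f W t x (∑ i, lam i • u i) ≤
          ((-ρ (W (t, x)) : ℝ) : EReal) + ⨆ i, PsiU D U f W ρ t x (u i)) := by
  refine ⟨?_, ?_⟩
  · intro t ht x
    obtain ⟨u, hu, hsub, -⟩ := hi t ht x
    refine (iInf_le _ (⟨u, hu⟩ : U)).trans ?_
    have hb : (⨆ v : (Uset D U f W t x u), supD D f W t x v.1) ≤
        ((-ρ (W (t, x)) + q t - DtV W t x : ℝ) : EReal) := by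
      refine iSup_le fun v => ?_
      have h2 := (hsub v.2).2
      generalize supD D f W t x v.1 = s at h2 ⊢
      induction s with
      | bot => exact bot_le
      | top =>
        rw [EReal.coe_add_top] at h2
        exact absurd (top_le_iff.mp h2) (EReal.coe_ne_top _)
      | coe r =>
        norm_cast at h2 ⊢
        linarith
    unfold PsiU
    refine (add_le_add le_rfl hb).trans ?_
    norm_cast
    linarith
  · intro t ht x p u hu lam hlam hsum
    have hne : Nonempty (Fin p) := by
      by_contra hcon
      rw [not_nonempty_iff] at hcon
      simp at hsum
    obtain ⟨i, hmax⟩ := Finite.exists_max (fun j => supD D f W t x (u j))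
    have hmem : (∑ j, lam j • u j) ∈ Uset D U f W t x (u i) := by
      apply subset_closure
      refine (convex_convexHull ℝ _).sum_mem (fun j _ => hlam j) hsum (fun j _ => ?_)
      exact subset_convexHull ℝ _ ⟨hu j, hmax j⟩
    have h1 : supD D f W t x (∑ j, lam j • u j) ≤
        ⨆ v : (Uset D U f W t x (u i)), supD D f W t x v.1 :=
      le_iSup (fun v : (Uset D U f W t x (u i)) => supD D f W t x v.1) ⟨_, hmem⟩
    have h2 : PsiU D U f W ρ t x (u i) ≤ ⨆ j, PsiU D U f W ρ t x (u j) :=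
      le_iSup (fun j => PsiU D U f W ρ t x (u j)) i
    refine le_trans ?_ (add_le_add le_rfl h2)
    unfold PsiU
    rw [← add_assoc, ← EReal.coe_add, neg_add_cancel_left]
    exact add_le_add le_rfl h1
end
end

section
/- Let V : [0,∞)×C⁰([−r,0];ℝⁿ) → ℝ be a locally bounded functional and let x : [t₀−r, t_max) → ℝⁿ be a solution of the RFDE system (4.3) with initial condition T_r(t₀)x = x₀ ∈ C⁰([−r,0];ℝⁿ) corresponding to some d ∈ M_D, where t_max ∈ (t₀,+∞] is the maximal existence time. Then for almost every t ∈ [t₀, t_max) the right derivative D⁺x(t) = lim_{h→0⁺} (x(t+h) − x(t))/h exists and limsup_{h→0⁺} h⁻¹( V(t+h, T_r(t+h)x) − V(t, T_r(t)x) ) ≤ V⁰(t, T_r(t)x; D⁺x(t)). -/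
open Filter Topology MeasureTheory Set RealInnerProductSpace

noncomputable section

/-- The state space C⁰([−r,0];ℝⁿ) with the sup norm. -/
abbrev Hist (n : ℕ) (r : ℝ) := C(Icc (-r) (0:ℝ), Euc n)

/-- The operator E_h(x;v) of Section 4.II: E_h(x;v)(θ) = x(0)+(θ+h)v for −h < θ ≤ 0 and
E_h(x;v)(θ) = x(θ+h) for −r ≤ θ ≤ −h. -/
def Ehist {n : ℕ} {r : ℝ} (h : ℝ) (x : Hist n r) (v : Euc n) : Hist n r :=
  if hr : -r ≤ 0 then
    { toFun := fun θ => if (θ : ℝ) ≤ -h then x (projIcc (-r) 0 hr ((θ : ℝ) + h))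
        else x (projIcc (-r) 0 hr 0) + ((θ : ℝ) + h) • v
      continuous_toFun := by
        apply Continuous.if_le
        · exact x.continuous.comp (continuous_projIcc.comp (by fun_prop))
        · exact continuous_const.add ((continuous_subtype_val.add continuous_const).smul
            continuous_const)
        · exact continuous_subtype_val
        · exact continuous_const
        · intro θ hθ
          rw [hθ]
          simp }
  else x

/-- The Dini derivative V⁰(t,x;v) of a functional V : [0,∞)×C⁰([−r,0];ℝⁿ) → ℝ:
V⁰(t,x;v) := limsup_{h→0⁺, y→0} (V(t+h, E_h(x;v)+h·y) − V(t,x))/h. -/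
def diniH {n : ℕ} {r : ℝ} (V : ℝ → Hist n r → ℝ) (t : ℝ) (x : Hist n r) (v : Euc n) :
    EReal :=
  Filter.limsup
    (fun p : ℝ × Hist n r =>
      (((V (t + p.1) (Ehist p.1 x v + p.1 • p.2) - V t x) / p.1 : ℝ) : EReal))
    ((𝓝[>] (0:ℝ)) ×ˢ 𝓝 0)

/-- The simplified Dini derivative V⁰(x;v) := limsup_{h→0⁺} (V(E_h(x;v)) − V(x))/h of a
time-independent functional. -/
def diniH0 {n : ℕ} {r : ℝ} (V : Hist n r → ℝ) (x : Hist n r) (v : Euc n) : EReal :=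
  Filter.limsup (fun h : ℝ => (((V (Ehist h x v) - V x) / h : ℝ) : EReal)) (𝓝[>] (0:ℝ))

/-- x : [t₀−r, tmax) → ℝⁿ (with history map φ) is a solution of the RFDE
ẋ(t) = F(t,d(t),T_r(t)x) with initial condition T_r(t₀)x = x₀, in integral form. -/
def IsSolutionRFDE {n l : ℕ} {r : ℝ} (F : ℝ → Euc l → Hist n r → Euc n)
    (d : ℝ → Euc l) (t₀ : ℝ) (x₀ : Hist n r) (tmax : EReal) (x : ℝ → Euc n)
    (φ : ℝ → Hist n r) : Prop :=
  (t₀ : EReal) < tmax ∧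
  φ t₀ = x₀ ∧
  (∀ t : ℝ, t₀ ≤ t → (t : EReal) < tmax → ∀ θ : Icc (-r) (0:ℝ), φ t θ = x (t + θ)) ∧
  ContinuousOn x {s : ℝ | t₀ - r ≤ s ∧ (s : EReal) < tmax} ∧
  (∀ t : ℝ, t₀ ≤ t → (t : EReal) < tmax → x t = x t₀ + ∫ s in t₀..t, F s (d s) (φ s))

/-- A functional V : [0,∞)×C⁰([−r,0];ℝⁿ) → [0,∞) which is
"almost Lipschitz on bounded sets" (Definition 4.5). -/
def AlmostLipschitzOn {n : ℕ} (r : ℝ) (V : ℝ → Hist n r → ℝ) : Prop :=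
  ContinuousOn (fun p : ℝ × Hist n r => V p.1 p.2) (Ici 0 ×ˢ univ) ∧
  ∃ LV P G : ℝ → ℝ, Monotone LV ∧ Monotone P ∧ Monotone G ∧ (∀ s, 1 ≤ G s) ∧
    (∀ R, 0 ≤ R → ∀ t ∈ Icc (0:ℝ) R, ∀ x y : Hist n r, ‖x‖ ≤ R → ‖y‖ ≤ R →
      |V t y - V t x| ≤ LV R * ‖y - x‖) ∧
    (∀ R, 0 ≤ R → ∀ M : ℝ, 0 ≤ M → ∀ x : Hist n r, ‖x‖ ≤ R →
      LipschitzWith (Real.toNNReal M) (fun θ : Icc (-r) (0:ℝ) => x θ) →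
      ∀ t ∈ Icc (0:ℝ) R, ∀ h : ℝ, 0 ≤ h → h ≤ 1 / G (R + M) →
        |V (t + h) x - V t x| ≤ h * P R * (1 + M))

/-- RGAOS (Definition 4.2) of the system ẋ(t) = F(t,d(t),T_r(t)x), Y(t) = H(t,T_r(t)x),
phrased via the existence of a family of unique maximal solutions satisfying robust
forward completeness and properties P1, P2. -/
def RGAOSrfde {n l : ℕ} {Y : Type*} [NormedAddCommGroup Y] [NormedSpace ℝ Y] (r : ℝ)
    (D : Set (Euc l)) (F : ℝ → Euc l → Hist n r → Euc n) (H : ℝ → Hist n r → Y) : Prop :=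
  ∃ (X : ℝ → Hist n r → (ℝ → Euc l) → ℝ → Euc n)
    (Φ : ℝ → Hist n r → (ℝ → Euc l) → ℝ → Hist n r)
    (tmax : ℝ → Hist n r → (ℝ → Euc l) → EReal),
    (∀ t₀ : ℝ, 0 ≤ t₀ → ∀ x₀ d, InMD D d →
      IsSolutionRFDE F d t₀ x₀ (tmax t₀ x₀ d) (X t₀ x₀ d) (Φ t₀ x₀ d) ∧
      ∀ tm y ψ, IsSolutionRFDE F d t₀ x₀ tm y ψ → tm ≤ tmax t₀ x₀ d ∧
        ∀ t : ℝ, t₀ ≤ t → (t : EReal) < tm → ψ t = Φ t₀ x₀ d t) ∧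
    -- robust forward completeness
    (∀ T, 0 ≤ T → ∀ s, 0 ≤ s → ∃ M, ∀ t₀ ∈ Icc (0:ℝ) T, ∀ ξ ∈ Icc (0:ℝ) T,
      ∀ x₀ : Hist n r, ‖x₀‖ ≤ s → ∀ d, InMD D d →
        ((t₀ + ξ : ℝ) : EReal) < tmax t₀ x₀ d ∧ ‖Φ t₀ x₀ d (t₀ + ξ)‖ ≤ M) ∧
    -- P1 (output stability)
    (∀ ε, 0 < ε → ∀ T, 0 ≤ T →
      (∃ M, ∀ t₀ ∈ Icc (0:ℝ) T, ∀ x₀ : Hist n r, ‖x₀‖ ≤ ε → ∀ d, InMD D d →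
        ∀ t : ℝ, t₀ ≤ t → (t : EReal) < tmax t₀ x₀ d → ‖H t (Φ t₀ x₀ d t)‖ ≤ M) ∧
      (∃ δ, 0 < δ ∧ ∀ t₀ ∈ Icc (0:ℝ) T, ∀ x₀ : Hist n r, ‖x₀‖ ≤ δ → ∀ d, InMD D d →
        ∀ t : ℝ, t₀ ≤ t → (t : EReal) < tmax t₀ x₀ d → ‖H t (Φ t₀ x₀ d t)‖ ≤ ε)) ∧
    -- P2 (uniform output attractivity on bounded sets of initial data)
    (∀ ε, 0 < ε → ∀ T, 0 ≤ T → ∀ R, 0 ≤ R → ∃ τ, 0 ≤ τ ∧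
      ∀ t₀ ∈ Icc (0:ℝ) T, ∀ x₀ : Hist n r, ‖x₀‖ ≤ R → ∀ d, InMD D d →
        ∀ t : ℝ, t₀ + τ ≤ t → (t : EReal) < tmax t₀ x₀ d → ‖H t (Φ t₀ x₀ d t)‖ ≤ ε)

/-- URGAOS (Definition 4.3) of the system ẋ(t) = F(t,d(t),T_r(t)x), Y(t) = H(t,T_r(t)x). -/
def URGAOSrfde {n l : ℕ} {Y : Type*} [NormedAddCommGroup Y] [NormedSpace ℝ Y] (r : ℝ)
    (D : Set (Euc l)) (F : ℝ → Euc l → Hist n r → Euc n) (H : ℝ → Hist n r → Y) : Prop :=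
  ∃ (X : ℝ → Hist n r → (ℝ → Euc l) → ℝ → Euc n)
    (Φ : ℝ → Hist n r → (ℝ → Euc l) → ℝ → Hist n r)
    (tmax : ℝ → Hist n r → (ℝ → Euc l) → EReal),
    (∀ t₀ : ℝ, 0 ≤ t₀ → ∀ x₀ d, InMD D d →
      IsSolutionRFDE F d t₀ x₀ (tmax t₀ x₀ d) (X t₀ x₀ d) (Φ t₀ x₀ d) ∧
      ∀ tm y ψ, IsSolutionRFDE F d t₀ x₀ tm y ψ → tm ≤ tmax t₀ x₀ d ∧
        ∀ t : ℝ, t₀ ≤ t → (t : EReal) < tm → ψ t = Φ t₀ x₀ d t) ∧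
    (∀ T, 0 ≤ T → ∀ s, 0 ≤ s → ∃ M, ∀ t₀ ∈ Icc (0:ℝ) T, ∀ ξ ∈ Icc (0:ℝ) T,
      ∀ x₀ : Hist n r, ‖x₀‖ ≤ s → ∀ d, InMD D d →
        ((t₀ + ξ : ℝ) : EReal) < tmax t₀ x₀ d ∧ ‖Φ t₀ x₀ d (t₀ + ξ)‖ ≤ M) ∧
    (∀ ε, 0 < ε →
      (∃ M, ∀ t₀ : ℝ, 0 ≤ t₀ → ∀ x₀ : Hist n r, ‖x₀‖ ≤ ε → ∀ d, InMD D d →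
        ∀ t : ℝ, t₀ ≤ t → (t : EReal) < tmax t₀ x₀ d → ‖H t (Φ t₀ x₀ d t)‖ ≤ M) ∧
      (∃ δ, 0 < δ ∧ ∀ t₀ : ℝ, 0 ≤ t₀ → ∀ x₀ : Hist n r, ‖x₀‖ ≤ δ → ∀ d, InMD D d →
        ∀ t : ℝ, t₀ ≤ t → (t : EReal) < tmax t₀ x₀ d → ‖H t (Φ t₀ x₀ d t)‖ ≤ ε)) ∧
    (∀ ε, 0 < ε → ∀ R, 0 ≤ R → ∃ τ, 0 ≤ τ ∧
      ∀ t₀ : ℝ, 0 ≤ t₀ → ∀ x₀ : Hist n r, ‖x₀‖ ≤ R → ∀ d, InMD D d →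
        ∀ t : ℝ, t₀ + τ ≤ t → (t : EReal) < tmax t₀ x₀ d → ‖H t (Φ t₀ x₀ d t)‖ ≤ ε)

theorem rightDeriv_limsup {n : ℕ} (r : ℝ) (hr : 0 < r) (V : ℝ → Hist n r → ℝ)
    (t₀ : ℝ) (tmax : EReal) (x : ℝ → Euc n) (φ : ℝ → Hist n r)
    (hφ : ∀ t : ℝ, t₀ ≤ t → (t : EReal) < tmax → ∀ θ : Icc (-r) (0:ℝ), φ t θ = x (t + θ))
    (t : ℝ) (ht : t₀ ≤ t) (htm : (t : EReal) < tmax) (L : Euc n)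
    (hL : Tendsto (fun h : ℝ => h⁻¹ • (x (t + h) - x t)) (𝓝[>] 0) (𝓝 L)) :
    Filter.limsup
          (fun h : ℝ => (((V (t + h) (φ (t + h)) - V t (φ t)) / h : ℝ) : EReal))
          (𝓝[>] 0) ≤ diniH V t (φ t) L := by
  have hr' : -r ≤ 0 := by linarith
  set y : ℝ → Hist n r := fun h => h⁻¹ • (φ (t + h) - Ehist h (φ t) L) with hy
  have hev : ∀ᶠ h in 𝓝[>] (0:ℝ), ((t + h : ℝ) : EReal) < tmax := by
    obtain ⟨q, hq1, hq2⟩ := EReal.lt_iff_exists_real_btwn.1 htm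
    have hq1' : t < q := by exact_mod_cast hq1
    have : Ioo (0:ℝ) (q - t) ∈ 𝓝[>] (0:ℝ) := Ioo_mem_nhdsGT (by linarith)
    filter_upwards [this] with h hh
    refine lt_trans ?_ hq2
    exact_mod_cast (by linarith [hh.2] : t + h < q)
  have hpos : ∀ᶠ h in 𝓝[>] (0:ℝ), 0 < h := eventually_mem_nhdsWithin
  have hy0 : Tendsto y (𝓝[>] 0) (𝓝 0) := by
    rw [Metric.tendsto_nhds]
    intro ε hε
    have h1 := (Metric.tendsto_nhds.1 hL) (ε / 2) (by linarith)
    obtain ⟨δ, hδ, h2⟩ := mem_nhdsGT_iff_exists_Ioo_subset.1 h1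
    have h3 : Ioo (0:ℝ) δ ∈ 𝓝[>] (0:ℝ) := Ioo_mem_nhdsGT hδ
    filter_upwards [hev, hpos, h3] with h hh hp hhδ
    rw [dist_zero_right]
    refine lt_of_le_of_lt ?_ (by linarith : ε / 2 < ε)
    rw [ContinuousMap.norm_le _ (by linarith)]
    intro θ
    have e1 : φ (t + h) θ = x (t + h + θ) := hφ _ (by linarith) hh θ
    have hθ := θ.2
    simp only [hy, ContinuousMap.smul_apply, ContinuousMap.sub_apply, e1, Ehist, dif_pos hr',
      ContinuousMap.coe_mk]
    split_ifs with hc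
    · rw [hφ t ht htm, projIcc_of_mem hr' (show (θ:ℝ) + h ∈ Icc (-r) 0 from
        ⟨by linarith [hθ.1], by linarith⟩)]
      simp only
      rw [show t + ((θ:ℝ) + h) = t + h + θ by ring]
      simp
      linarith
    · rw [hφ t ht htm, projIcc_of_mem hr' (show (0:ℝ) ∈ Icc (-r) 0 from ⟨hr', le_rfl⟩)]
      simp only [add_zero]
      push Not at hc
      set s : ℝ := (θ:ℝ) + h with hs
      have hs0 : 0 < s := by linarith
      have hsh : s ≤ h := by linarith [hθ.2]
      have h4 := h2 (show s ∈ Ioo 0 δ from ⟨hs0, lt_of_le_of_lt hsh hhδ.2⟩)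
      simp only [mem_setOf_eq, dist_eq_norm] at h4
      have e2 : x (t + h + θ) - (x t + s • L) = s • (s⁻¹ • (x (t + s) - x t) - L) := by
        rw [smul_sub, smul_smul, mul_inv_cancel₀ hs0.ne', one_smul,
          show t + h + (θ:ℝ) = t + s by rw [hs]; ring]
        abel
      rw [e2, norm_smul, norm_smul, Real.norm_of_nonneg (inv_nonneg.2 hp.le),
        Real.norm_of_nonneg hs0.le, ← mul_assoc]
      have h5 : h⁻¹ * s ≤ 1 := by
        rw [inv_mul_le_iff₀ hp]; linarith
      calc _ ≤ 1 * (ε / 2) := mul_le_mul h5 h4.le (norm_nonneg _) zero_le_one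
        _ = _ := one_mul _
  have hm : Tendsto (fun h : ℝ => (h, y h)) (𝓝[>] 0) ((𝓝[>] (0:ℝ)) ×ˢ 𝓝 0) :=
    tendsto_id.prodMk hy0
  have key : (fun h : ℝ => (((V (t + h) (φ (t + h)) - V t (φ t)) / h : ℝ) : EReal))
      =ᶠ[𝓝[>] 0] (fun p : ℝ × Hist n r =>
      (((V (t + p.1) (Ehist p.1 (φ t) L + p.1 • p.2) - V t (φ t)) / p.1 : ℝ) : EReal)) ∘
        (fun h : ℝ => (h, y h)) := by
    filter_upwards [hpos] with h hp
    simp only [Function.comp, hy]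
    rw [smul_smul, mul_inv_cancel₀ hp.ne', one_smul, add_sub_cancel]
  rw [limsup_congr key, diniH, limsup, ← Filter.map_map, ]
  exact limsSup_le_limsSup_of_le (Filter.map_mono hm)

theorem ae_rightDeriv {n : ℕ} (t₀ : ℝ) (tmax : EReal) (x : ℝ → Euc n) (g : ℝ → Euc n)
    (hx : ∀ t : ℝ, t₀ ≤ t → (t : EReal) < tmax → x t = x t₀ + ∫ s in t₀..t, g s) :
    ∀ᵐ t : ℝ, t₀ ≤ t → (t : EReal) < tmax →
      ∃ L : Euc n, Tendsto (fun h : ℝ => h⁻¹ • (x (t + h) - x t)) (𝓝[>] 0) (𝓝 L) := by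
  have hsub : ∀ {a b : ℝ}, t₀ ≤ a → a ≤ b → IntervalIntegrable g volume t₀ b →
      IntervalIntegrable g volume t₀ a := by
    intro a b ha hab hb
    refine hb.mono_set ?_
    rw [uIcc_of_le ha, uIcc_of_le (ha.trans hab)]
    exact Icc_subset_Icc_right hab
  have hnull : ∀ᵐ t : ℝ, ¬ (t₀ ≤ t ∧ IntervalIntegrable g volume t₀ t ∧
      ∀ q, t < q → ¬ IntervalIntegrable g volume t₀ q) := by
    rw [ae_iff]
    refine Set.Subsingleton.measure_zero ?_ _
    intro a ha b hb
    simp only [not_not, mem_setOf_eq] at ha hb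
    rcases lt_trichotomy a b with h | h | h
    · exact absurd hb.2.1 (ha.2.2 b h)
    · exact h
    · exact absurd ha.2.1 (hb.2.2 a h)
  have hder : ∀ᵐ t : ℝ, ∀ q : ℚ, IntervalIntegrable g volume t₀ q → t ∈ uIcc t₀ (q:ℝ) →
      HasDerivAt (fun u => ∫ s in t₀..u, g s) (g t) t := by
    rw [ae_all_iff]
    intro q
    by_cases hq : IntervalIntegrable g volume t₀ q
    · filter_upwards [hq.ae_hasDerivAt_integral] with t ht _ htm
      exact ht htm t₀ left_mem_uIcc
    · exact Eventually.of_forall fun _ h => absurd h hq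
  filter_upwards [hnull, hder] with t h1 h2 ht htm
  have hev : ∀ᶠ h in 𝓝[>] (0:ℝ), ((t + h : ℝ) : EReal) < tmax := by
    obtain ⟨q, hq1, hq2⟩ := EReal.lt_iff_exists_real_btwn.1 htm
    have hq1' : t < q := by exact_mod_cast hq1
    have : Ioo (0:ℝ) (q - t) ∈ 𝓝[>] (0:ℝ) := Ioo_mem_nhdsGT (by linarith)
    filter_upwards [this] with h hh
    refine lt_trans ?_ hq2
    exact_mod_cast (by linarith [hh.2] : t + h < q)
  have hpos : ∀ᶠ h in 𝓝[>] (0:ℝ), 0 < h := eventually_mem_nhdsWithin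
  by_cases hi : IntervalIntegrable g volume t₀ t
  · push Not at h1
    obtain ⟨q, hq, hqi⟩ := h1 ht hi
    obtain ⟨p, hp1, hp2⟩ := exists_rat_btwn hq
    have hd := h2 p (hsub (by linarith) hp2.le hqi) (by
      rw [uIcc_of_le (by linarith)]; exact ⟨ht, hp1.le⟩)
    refine ⟨g t, ?_⟩
    have hd' := hd.tendsto_slope_zero_right
    refine hd'.congr' ?_
    filter_upwards [hev, hpos] with h hh hp
    rw [hx t ht htm, hx (t + h) (by linarith) hh, add_sub_add_left_eq_sub]
  · refine ⟨0, ?_⟩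
    refine tendsto_const_nhds.congr' ?_
    filter_upwards [hev, hpos] with h hh hp
    rw [hx t ht htm, hx (t + h) (by linarith) hh, intervalIntegral.integral_undef hi,
      intervalIntegral.integral_undef (fun hc => hi (hsub ht (by linarith) hc))]
    simp

/-- Lemma 4.4: along any solution of the RFDE (4.3), for almost every t the right
derivative D⁺x(t) exists and the upper right Dini derivative of t ↦ V(t,T_r(t)x) is
bounded by V⁰(t,T_r(t)x;D⁺x(t)). -/
theorem stmt11 {n l : ℕ} (r : ℝ) (hr : 0 < r)
    (D : Set (Euc l)) (hD : IsCompact D) (hDne : D.Nonempty)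
    (f : ℝ → Euc l → Hist n r → Euc n)
    (hf0 : ∀ t : ℝ, 0 ≤ t → ∀ d ∈ D, f t d 0 = 0)
    -- (Q1)
    (hQ1a : ∀ t : ℝ, 0 ≤ t →
      ContinuousOn (fun p : Hist n r × Euc l => f t p.2 p.1) (univ ×ˢ D))
    (hQ1b : ∀ T, 0 ≤ T → ∀ R, 0 ≤ R → ∃ L, ∀ t ∈ Icc (0:ℝ) T, ∀ d ∈ D,
      ∀ x y : Hist n r, ‖x‖ ≤ R → ‖y‖ ≤ R →
        ⟪x ⟨0, ⟨by linarith, le_rfl⟩⟩ - y ⟨0, ⟨by linarith, le_rfl⟩⟩,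
          f t d x - f t d y⟫ ≤ L * ‖x - y‖ ^ 2)
    -- (Q2)
    (hQ2 : ∀ T, 0 ≤ T → ∀ R, 0 ≤ R → ∃ M, ∀ t ∈ Icc (0:ℝ) T, ∀ d ∈ D,
      ∀ x : Hist n r, ‖x‖ ≤ R → ‖f t d x‖ ≤ M)
    -- (Q3)
    (hQ3 : ∃ A : Set ℝ, A.Countable ∧ (∀ K : Set ℝ, IsCompact K → (A ∩ K).Finite) ∧
      ContinuousOn (fun p : ℝ × Hist n r × Euc l => f p.1 p.2.2 p.2.1)
        ((Ici 0 \ A) ×ˢ univ ×ˢ D) ∧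
      ∀ t₀ : ℝ, 0 ≤ t₀ → ∀ x : Hist n r, ∀ d ∈ D,
        Tendsto (fun t => f t d x) (𝓝[>] t₀) (𝓝 (f t₀ d x)))
    -- (Q4)
    (hQ4 : ∀ ε, 0 < ε → ∀ t : ℝ, 0 ≤ t → ∃ δ, 0 < δ ∧ ∀ τ : ℝ, 0 ≤ τ → ∀ d ∈ D,
      ∀ x : Hist n r, |τ - t| + ‖x‖ < δ → ‖f τ d x‖ < ε)
    -- V locally bounded
    (V : ℝ → Hist n r → ℝ)
    (hVloc : ∀ (t : ℝ) (x : Hist n r), ∃ ε, 0 < ε ∧ ∃ M, ∀ (s : ℝ) (y : Hist n r),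
      |s - t| < ε → ‖y - x‖ < ε → |V s y| ≤ M)
    -- the solution
    (d : ℝ → Euc l) (hd : InMD D d)
    (t₀ : ℝ) (ht₀ : 0 ≤ t₀) (x₀ : Hist n r) (tmax : EReal)
    (x : ℝ → Euc n) (φ : ℝ → Hist n r)
    (hsol : IsSolutionRFDE f d t₀ x₀ tmax x φ) :
    ∀ᵐ t ∂(volume.restrict {t : ℝ | t₀ ≤ t ∧ (t : EReal) < tmax}),
      ∃ L : Euc n, Tendsto (fun h : ℝ => h⁻¹ • (x (t + h) - x t)) (𝓝[>] 0) (𝓝 L) ∧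
        Filter.limsup
          (fun h : ℝ => (((V (t + h) (φ (t + h)) - V t (φ t)) / h : ℝ) : EReal))
          (𝓝[>] 0) ≤ diniH V t (φ t) L := by
  obtain ⟨_, _, hφ, _, hx⟩ := hsol
  have hms : MeasurableSet {t : ℝ | t₀ ≤ t ∧ (t : EReal) < tmax} :=
    measurableSet_Ici.inter (measurable_coe_real_ereal measurableSet_Iio)
  rw [ae_restrict_iff' hms]
  filter_upwards [ae_rightDeriv t₀ tmax x _ hx] with t h ht
  obtain ⟨L, hL⟩ := h ht.1 ht.2
  exact ⟨L, hL, rightDeriv_limsup r hr V t₀ tmax x φ hφ t ht.1 ht.2 L hL⟩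
end
end
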